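/- arXiv:2012.08144 — 2 statements merged into one kernel-verified Lean document; each statement's English description precedes it below -/
import Mathlib

section
/- Let n ≥ 2 and m ≥ 2n + 2, and let 1 ≤ i < j ≤ n. Then √(I_m^i + I_m^j) = ⋂_{u=0}^{n+1−(j−i)} (L_{j+u, 2n+2−j−u, 2} + ⟨f^{(2n+2)},…,f^{(m)}⟩), each ideal L_{j+u, 2n+2−j−u, 2} + ⟨f^{(2n+2)},…,f^{(m)}⟩ (0 ≤ u ≤ n+1−(j−i)) is prime, and none of these ideals contains another; consequently Z_m^i ∩ Z_m^j = ⋃_{u=0}^{n+1−(j−i)} V(L_{j+u, 2n+2−j−u, 2} + ⟨f^{(2n+2)},…,f^{(m)}⟩) is the irreducible decomposition of Z_m^i ∩ Z_m^j. -/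
noncomputable section

open MvPolynomial

/-- `R N = ℂ[x_0,…,x_N, y_0,…,y_N, z_0,…,z_N]`. -/
abbrev R (N : ℕ) : Type := MvPolynomial (Fin 3 × Fin (N + 1)) ℂ

/-- the variable `x_i` (for `i ≤ N`). -/
def Xv (N i : ℕ) : R N := if h : i < N + 1 then X (0, ⟨i, h⟩) else 0
/-- the variable `y_i` (for `i ≤ N`). -/
def Yv (N i : ℕ) : R N := if h : i < N + 1 then X (1, ⟨i, h⟩) else 0
/-- the variable `z_i` (for `i ≤ N`). -/
def Zv (N i : ℕ) : R N := if h : i < N + 1 then X (2, ⟨i, h⟩) else 0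

/-- `Σ_{i=p}^N x_i t^i`. -/
def xSer (N p : ℕ) : Polynomial (R N) :=
  ∑ i ∈ Finset.Icc p N, Polynomial.C (Xv N i) * Polynomial.X ^ i
/-- `Σ_{i=q}^N y_i t^i`. -/
def ySer (N q : ℕ) : Polynomial (R N) :=
  ∑ i ∈ Finset.Icc q N, Polynomial.C (Yv N i) * Polynomial.X ^ i
/-- `Σ_{i=r}^N z_i t^i`. -/
def zSer (N r : ℕ) : Polynomial (R N) :=
  ∑ i ∈ Finset.Icc r N, Polynomial.C (Zv N i) * Polynomial.X ^ i

/-- `f_{pqr}^{(j)}`: the coefficient of `t^j` in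
`f(Σ_{i=p}^N x_i t^i, Σ_{i=q}^N y_i t^i, Σ_{i=r}^N z_i t^i)` where `f = xy - z^{n+1}`. -/
def fpqr (N n p q r j : ℕ) : R N :=
  (xSer N p * ySer N q - zSer N r ^ (n + 1)).coeff j


/-- The ideal `L_{pqr} = ⟨x_0,…,x_{p−1}, y_0,…,y_{q−1}, z_0,…,z_{r−1}⟩`. -/
def Lpqr (N p q r : ℕ) : Ideal (R N) :=
  Ideal.span ((Xv N '' Set.Iio p) ∪ (Yv N '' Set.Iio q) ∪ (Zv N '' Set.Iio r))

/-- The substitution `x_i ↦ x_{l+i}`, `y_i ↦ y_{e(n+1)−l+i}`, `z_i ↦ z_{e+i}`. -/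
def shiftSub (N n l e : ℕ) : Fin 3 × Fin (N + 1) → R N := fun v =>
  if v.1 = 0 then Xv N (l + (v.2 : ℕ))
  else if v.1 = 1 then Yv N (e * (n + 1) - l + (v.2 : ℕ))
  else Zv N (e + (v.2 : ℕ))

/-- `g_{l,e}^{(j)}`: obtained from `f^{(j)} = f_{000}^{(j)}` by the substitution
`x_i ↦ x_{l+i}`, `y_i ↦ y_{e(n+1)−l+i}`, `z_i ↦ z_{e+i}`. -/
def gle (N n l e j : ℕ) : R N := aeval (shiftSub N n l e) (fpqr N n 0 0 0 j)

/-- The ideal `⟨f^{(0)},…,f^{(m)}⟩` of `R_m`. -/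
def Fideal (m n : ℕ) : Ideal (R m) :=
  Ideal.span {g | ∃ j ≤ m, g = fpqr m n 0 0 0 j}

/-- `I_m^l = L_{l,n+1−l,1} + ⟨f^{(0)},…,f^{(m)}⟩`. -/
def Iml (m n l : ℕ) : Ideal (R m) := Lpqr m l (n + 1 - l) 1 ⊔ Fideal m n

/-- `G_m^l = ⟨g_{l,1}^{(0)},…,g_{l,1}^{(m−n−1)}⟩` (the zero ideal when `m = n`). -/
def Gml (m n l : ℕ) : Ideal (R m) :=
  Ideal.span {g | ∃ j < m - n, g = gle m n l 1 j}

/-- Points of `ℂ^{3(m+1)}`. -/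
abbrev Pt (m : ℕ) := Fin 3 × Fin (m + 1) → ℂ

/-- The zero locus in `ℂ^{3(m+1)}` of an ideal of `R_m`. -/
def zl (m : ℕ) (I : Ideal (R m)) : Set (Pt m) := {x | ∀ g ∈ I, eval x g = 0}

/-- `Z_m^l ⊆ ℂ^{3(m+1)}`, the zero locus of `I_m^l`. -/
def Zml (m n l : ℕ) : Set (Pt m) := zl m (Iml m n l)

/-- A subset of `ℂ^{3(m+1)}` is irreducible with respect to the Zariski topology,
whose closed sets are exactly the zero loci of ideals of `R_m`. -/
def IsIrredSet (m : ℕ) (S : Set (Pt m)) : Prop :=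
  S.Nonempty ∧
    ∀ I₁ I₂ : Ideal (R m), S ⊆ zl m I₁ ∪ zl m I₂ → S ⊆ zl m I₁ ∨ S ⊆ zl m I₂

/-- The ideal `⟨f^{(2n+2)},…,f^{(m)}⟩` of `R_m`. -/
def Fideal2 (m n : ℕ) : Ideal (R m) :=
  Ideal.span {g | ∃ k, 2 * n + 2 ≤ k ∧ k ≤ m ∧ g = fpqr m n 0 0 0 k}

/-- The ideal `L_{j+u, 2n+2−j−u, 2} + ⟨f^{(2n+2)},…,f^{(m)}⟩` of `R_m`. -/
def Kml (m n j u : ℕ) : Ideal (R m) :=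
  Lpqr m (j + u) (2 * n + 2 - j - u) 2 ⊔ Fideal2 m n

/-! ### A free extension over which a monic polynomial splits universally -/

open Polynomial in
/-- Every monic polynomial `P` over `D` splits over a free `D`-algebra that is universal for
homomorphisms from `D` along which `P` splits. -/
theorem exists_free_universal_splitting (N : ℕ) :
    ∀ (D : Type) [CommRing D] (P : Polynomial D), P.Monic → P.natDegree = N →
    ∃ (E : Type) (_ : CommRing E) (_ : Algebra D E) (α : ℕ → E),
      Module.Free D E ∧ Function.Injective (algebraMap D E) ∧
      P.map (algebraMap D E) = ∏ i ∈ Finset.range N, (Polynomial.X - Polynomial.C (α i)) ∧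
      ∀ (B : Type) [CommRing B] (φ : D →+* B) (β : ℕ → B),
        P.map φ = ∏ i ∈ Finset.range N, (Polynomial.X - Polynomial.C (β i)) →
        ∃ θ : E →+* B, θ.comp (algebraMap D E) = φ ∧ ∀ i < N, θ (α i) = β i := by
  induction N with
  | zero =>
    intro D _ P hP hN
    have hP1 : P = 1 := Polynomial.eq_one_of_monic_natDegree_zero hP hN
    refine ⟨D, inferInstance, inferInstance, fun _ => 0, inferInstance,
      Function.injective_id, by simp [hP1], fun B _ φ β _ => ⟨φ, by ext; simp, by simp⟩⟩
  | succ N ih =>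
    intro D _ P hP hN
    rcases subsingleton_or_nontrivial D with hD | hD
    · exact absurd hN (by rw [Subsingleton.elim P 0]; simp)
    let D₁ := AdjoinRoot P
    have hinj₁ : Function.Injective (AdjoinRoot.of P) := by
      rw [injective_iff_map_eq_zero]
      intro d hd
      have h : P ∣ Polynomial.C d := AdjoinRoot.mk_eq_zero.mp hd
      by_contra hd0
      exact hP.not_dvd_of_natDegree_lt (by simpa using hd0) (by simp [hN]) h
    have hmonic : (P.map (AdjoinRoot.of P)).Monic := hP.map _
    have : Nontrivial D₁ := hinj₁.nontrivial
    have hfac : (Polynomial.X - Polynomial.C (AdjoinRoot.root P)) *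
        (P.map (AdjoinRoot.of P) /ₘ (Polynomial.X - Polynomial.C (AdjoinRoot.root P))) =
          P.map (AdjoinRoot.of P) :=
      mul_divByMonic_eq_iff_isRoot.mpr (AdjoinRoot.isRoot_root P)
    set Q := P.map (AdjoinRoot.of P) /ₘ (Polynomial.X - Polynomial.C (AdjoinRoot.root P)) with hQ
    have hQm : Q.Monic := (monic_X_sub_C _).of_mul_monic_left (hfac ▸ hmonic)
    have hQd : Q.natDegree = N := by
      have := (monic_X_sub_C (AdjoinRoot.root P)).natDegree_mul hQm
      rw [hfac, hP.natDegree_map, hN, natDegree_X_sub_C] at this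
      omega
    obtain ⟨E, _, _, α, hfree, hinj, hprod, huniv⟩ := ih D₁ Q hQm hQd
    let alg : Algebra D E := ((algebraMap D₁ E).comp (AdjoinRoot.of P)).toAlgebra
    have tower : IsScalarTower D D₁ E := IsScalarTower.of_algebraMap_eq' rfl
    have := hP.free_adjoinRoot
    refine ⟨E, inferInstance, alg,
      fun i => if i = N then algebraMap D₁ E (AdjoinRoot.root P) else α i,
      Module.Free.trans (S := D₁), hinj.comp hinj₁, ?_, ?_⟩
    · change P.map ((algebraMap D₁ E).comp (AdjoinRoot.of P)) = _
      rw [← Polynomial.map_map, ← hfac, Polynomial.map_mul, hprod, Finset.prod_range_succ, mul_comm]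
      congr 1
      · refine Finset.prod_congr rfl fun i hi => ?_
        simp [(Finset.mem_range.mp hi).ne]
      · simp
    · intro B _ φ β hβ
      let φ₁ : D₁ →+* B := AdjoinRoot.lift φ (β N) (by
        rw [← Polynomial.eval_map, hβ, Polynomial.eval_prod]
        exact Finset.prod_eq_zero (Finset.self_mem_range_succ N) (by simp))
      have hφ₁ : φ₁.comp (AdjoinRoot.of P) = φ := AdjoinRoot.lift_comp_of _
      have hroot : φ₁ (AdjoinRoot.root P) = β N := AdjoinRoot.lift_root _
      obtain ⟨θ, hθ, hθα⟩ := huniv B φ₁ β (by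
        apply (monic_X_sub_C (β N)).isRegular.left
        have h := congrArg (Polynomial.map φ₁) hfac
        rw [Polynomial.map_map, hφ₁, hβ, Finset.prod_range_succ, Polynomial.map_mul] at h
        simpa [hroot, mul_comm] using h)
      refine ⟨θ, ?_, fun i hi => ?_⟩
      · change θ.comp ((algebraMap D₁ E).comp (AdjoinRoot.of P)) = φ
        rw [← RingHom.comp_assoc, hθ, hφ₁]
      · by_cases h : i = N
        · subst h
          simpa [hroot] using DFunLike.congr_fun hθ (AdjoinRoot.root P)
        · simpa [h] using hθα i (by omega)

/-! ### The power series attached to an arc -/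

namespace PowerSeries

theorem mk_eq_X_pow_mul {S : Type*} [CommRing S] {p : ℕ} {a : ℕ → S} (h : ∀ i < p, a i = 0) :
    mk a = X ^ p * mk (fun i => a (p + i)) := by
  ext k
  rw [coeff_X_pow_mul']
  split_ifs with hk
  · simp [Nat.add_sub_cancel' hk]
  · simp [h k (not_le.mp hk)]

end PowerSeries

/-- The power series `xy - z^{n+1}` attached to three sequences. -/
def arcSeries {S : Type*} [CommRing S] (n : ℕ) (x y z : ℕ → S) : PowerSeries S :=
  PowerSeries.mk x * PowerSeries.mk y - PowerSeries.mk z ^ (n + 1)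

theorem coeff_arcSeries_congr {S : Type*} [CommRing S] {n k : ℕ} {a a' b b' c c' : ℕ → S}
    (ha : ∀ i ≤ k, a i = a' i) (hb : ∀ i ≤ k, b i = b' i) (hc : ∀ i ≤ k, c i = c' i) :
    PowerSeries.coeff k (arcSeries n a b c) = PowerSeries.coeff k (arcSeries n a' b' c') := by
  have key : ∀ {d d' : ℕ → S}, (∀ i ≤ k, d i = d' i) →
      (PowerSeries.X : PowerSeries S) ^ (k + 1) ∣ PowerSeries.mk d - PowerSeries.mk d' :=
    fun h => PowerSeries.X_pow_dvd_iff.mpr fun i hi => by simp [h i (Nat.lt_succ_iff.mp hi)]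
  have h : (PowerSeries.X : PowerSeries S) ^ (k + 1) ∣
      arcSeries n a b c - arcSeries n a' b' c' := by
    have h₁ := ((key ha).mul_right (PowerSeries.mk b)).add ((key hb).mul_left (PowerSeries.mk a'))
    have h₂ := h₁.sub ((key hc).trans
      (sub_dvd_pow_sub_pow (PowerSeries.mk c) (PowerSeries.mk c') (n + 1)))
    convert h₂ using 1
    simp only [arcSeries]
    ring
  have := PowerSeries.X_pow_dvd_iff.mp h k (Nat.lt_succ_self k)
  rwa [map_sub, sub_eq_zero] at this

/-! ### Ring homomorphisms and the polynomials `f^{(k)}` -/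

theorem coe_xSer (m : ℕ) : (xSer m 0 : PowerSeries (R m)) = PowerSeries.mk (Xv m) := by
  ext k
  simp only [Polynomial.coeff_coe, xSer, Polynomial.finsetSum_coeff, Polynomial.coeff_C_mul_X_pow,
    PowerSeries.coeff_mk, Finset.sum_ite_eq, Finset.mem_Icc, zero_le, true_and]
  split_ifs with h
  · rfl
  · simp [Xv, show ¬ k < m + 1 by omega]

theorem coe_ySer (m : ℕ) : (ySer m 0 : PowerSeries (R m)) = PowerSeries.mk (Yv m) := by
  ext k
  simp only [Polynomial.coeff_coe, ySer, Polynomial.finsetSum_coeff, Polynomial.coeff_C_mul_X_pow,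
    PowerSeries.coeff_mk, Finset.sum_ite_eq, Finset.mem_Icc, zero_le, true_and]
  split_ifs with h
  · rfl
  · simp [Yv, show ¬ k < m + 1 by omega]

theorem coe_zSer (m : ℕ) : (zSer m 0 : PowerSeries (R m)) = PowerSeries.mk (Zv m) := by
  ext k
  simp only [Polynomial.coeff_coe, zSer, Polynomial.finsetSum_coeff, Polynomial.coeff_C_mul_X_pow,
    PowerSeries.coeff_mk, Finset.sum_ite_eq, Finset.mem_Icc, zero_le, true_and]
  split_ifs with h
  · rfl
  · simp [Zv, show ¬ k < m + 1 by omega]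

section RingHom

variable {S : Type*} [CommRing S] {m n : ℕ} (φ : R m →+* S)

theorem map_fpqr (k : ℕ) :
    φ (fpqr m n 0 0 0 k) = PowerSeries.coeff k
      (arcSeries n (fun i => φ (Xv m i)) (fun i => φ (Yv m i)) (fun i => φ (Zv m i))) := by
  have hmap : ∀ a : ℕ → R m,
      PowerSeries.mk (fun i => φ (a i)) = PowerSeries.map φ (PowerSeries.mk a) :=
    fun a => by ext; simp
  rw [fpqr, ← Polynomial.coeff_coe, Polynomial.coe_sub, Polynomial.coe_mul, Polynomial.coe_pow,
    coe_xSer, coe_ySer, coe_zSer, arcSeries, hmap, hmap, hmap, ← map_mul, ← map_pow, ← map_sub,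
    PowerSeries.coeff_map]

variable {φ}

theorem Lpqr_le_ker_iff {p q r : ℕ} :
    Lpqr m p q r ≤ RingHom.ker φ ↔
      (∀ i < p, φ (Xv m i) = 0) ∧ (∀ i < q, φ (Yv m i) = 0) ∧ ∀ i < r, φ (Zv m i) = 0 := by
  rw [Lpqr, Ideal.span_le, Set.union_subset_iff, Set.union_subset_iff, Set.image_subset_iff,
    Set.image_subset_iff, Set.image_subset_iff, and_assoc]
  rfl

theorem arcSeries_eq_X_pow_mul {p q : ℕ} (hpq : p + q = 2 * n + 2) {x y z : ℕ → S}
    (hx : ∀ i < p, x i = 0) (hy : ∀ i < q, y i = 0) (hz : ∀ i < 2, z i = 0) :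
    arcSeries n x y z = PowerSeries.X ^ (2 * n + 2) *
      arcSeries n (fun i => x (p + i)) (fun i => y (q + i)) (fun i => z (2 + i)) := by
  rw [arcSeries, PowerSeries.mk_eq_X_pow_mul hx, PowerSeries.mk_eq_X_pow_mul hy,
    PowerSeries.mk_eq_X_pow_mul hz, arcSeries, mul_pow, ← pow_mul,
    show 2 * (n + 1) = 2 * n + 2 by ring, mul_sub, ← hpq, pow_add]
  ring

/-- The ideal `L_{p,q,2} + ⟨f^{(2n+2)},…,f^{(m)}⟩`. -/
def Kideal (m n p q : ℕ) : Ideal (R m) := Lpqr m p q 2 ⊔ Fideal2 m n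

theorem Kideal_le_ker_iff {p q : ℕ} (hpq : p + q = 2 * n + 2) :
    Kideal m n p q ≤ RingHom.ker φ ↔
      ((∀ i < p, φ (Xv m i) = 0) ∧ (∀ i < q, φ (Yv m i) = 0) ∧ ∀ i < 2, φ (Zv m i) = 0) ∧
      ∀ k, 2 * n + 2 + k ≤ m → PowerSeries.coeff k (arcSeries n (fun i => φ (Xv m (p + i)))
        (fun i => φ (Yv m (q + i))) (fun i => φ (Zv m (2 + i)))) = 0 := by
  rw [Kideal, sup_le_iff, Lpqr_le_ker_iff]
  refine and_congr_right fun ⟨hx, hy, hz⟩ => ?_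
  have hshift : ∀ k, φ (fpqr m n 0 0 0 (2 * n + 2 + k)) =
      PowerSeries.coeff k (arcSeries n (fun i => φ (Xv m (p + i)))
        (fun i => φ (Yv m (q + i))) (fun i => φ (Zv m (2 + i)))) := fun k => by
    rw [map_fpqr, arcSeries_eq_X_pow_mul hpq hx hy hz, add_comm (2 * n + 2) k,
      PowerSeries.coeff_X_pow_mul]
  rw [Fideal2, Ideal.span_le]
  constructor
  · intro h k hk
    rw [← hshift]
    exact h ⟨_, by omega, hk, rfl⟩
  · rintro h _ ⟨k, hk, hkm, rfl⟩
    obtain ⟨k, rfl⟩ := Nat.exists_eq_add_of_le hk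
    exact (hshift k).trans (h k hkm)

theorem map_fpqr_eq_zero {p q : ℕ} (hpq : p + q = 2 * n + 2)
    (hK : Kideal m n p q ≤ RingHom.ker φ) {k : ℕ} (hk : k ≤ m) : φ (fpqr m n 0 0 0 k) = 0 := by
  obtain ⟨⟨hx, hy, hz⟩, h⟩ := (Kideal_le_ker_iff hpq).mp hK
  rw [map_fpqr, arcSeries_eq_X_pow_mul hpq hx hy hz, PowerSeries.coeff_X_pow_mul']
  split_ifs with hle
  · exact h _ (by omega)
  · rfl

end RingHom

section Construction

variable {S : Type*} [CommRing S] (m p q : ℕ) (c : ℂ →+* S) (x y z : ℕ → S)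

/-- The ring homomorphism `x_{p+i} ↦ x i`, `y_{q+i} ↦ y i`, `z_{2+i} ↦ z i`, sending the
variables of lower index to `0`. -/
def arcHom : R m →+* S := eval₂Hom c fun v =>
  if v.1 = 0 then (if (v.2 : ℕ) < p then 0 else x (v.2 - p))
  else if v.1 = 1 then (if (v.2 : ℕ) < q then 0 else y (v.2 - q))
  else if (v.2 : ℕ) < 2 then 0 else z (v.2 - 2)

@[simp]
theorem arcHom_C (a : ℂ) : arcHom m p q c x y z (C a) = c a := by simp [arcHom]

theorem arcHom_Xv_of_lt {i : ℕ} (hi : i < p) : arcHom m p q c x y z (Xv m i) = 0 := by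
  unfold Xv; split_ifs <;> simp [arcHom, hi]

theorem arcHom_Yv_of_lt {i : ℕ} (hi : i < q) : arcHom m p q c x y z (Yv m i) = 0 := by
  unfold Yv; split_ifs <;> simp [arcHom, hi]

theorem arcHom_Zv_of_lt {i : ℕ} (hi : i < 2) : arcHom m p q c x y z (Zv m i) = 0 := by
  unfold Zv; split_ifs <;> simp [arcHom]; omega

theorem arcHom_Xv {i : ℕ} (hi : p + i ≤ m) : arcHom m p q c x y z (Xv m (p + i)) = x i := by
  simp [Xv, Nat.lt_succ_iff.mpr hi, arcHom]

theorem arcHom_Yv {i : ℕ} (hi : q + i ≤ m) : arcHom m p q c x y z (Yv m (q + i)) = y i := by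
  simp [Yv, Nat.lt_succ_iff.mpr hi, arcHom]

theorem arcHom_Zv {i : ℕ} (hi : 2 + i ≤ m) : arcHom m p q c x y z (Zv m (2 + i)) = z i := by
  simp [Zv, Nat.lt_succ_iff.mpr hi, arcHom]; omega

variable {m p q c x y z}

theorem Kideal_le_ker_arcHom {n : ℕ} (hn : 1 ≤ n) (hpq : p + q = 2 * n + 2)
    (h : ∀ k, 2 * n + 2 + k ≤ m → PowerSeries.coeff k (arcSeries n x y z) = 0) :
    Kideal m n p q ≤ RingHom.ker (arcHom m p q c x y z) := by
  refine (Kideal_le_ker_iff hpq).mpr ⟨⟨fun i => arcHom_Xv_of_lt m p q c x y z,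
    fun i => arcHom_Yv_of_lt m p q c x y z, fun i => arcHom_Zv_of_lt m p q c x y z⟩,
    fun k hk => (coeff_arcSeries_congr ?_ ?_ ?_).trans (h k hk)⟩
  · exact fun i hi => arcHom_Xv m p q c x y z (by omega)
  · exact fun i hi => arcHom_Yv m p q c x y z (by omega)
  · exact fun i hi => arcHom_Zv m p q c x y z (by omega)

theorem ringHom_ext_of_Lpqr {φ ψ : R m →+* S} (hC : ∀ a, φ (C a) = ψ (C a))
    (hφ : Lpqr m p q 2 ≤ RingHom.ker φ) (hψ : Lpqr m p q 2 ≤ RingHom.ker ψ)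
    (hx : ∀ i, p + i ≤ m → φ (Xv m (p + i)) = ψ (Xv m (p + i)))
    (hy : ∀ i, q + i ≤ m → φ (Yv m (q + i)) = ψ (Yv m (q + i)))
    (hz : ∀ i, 2 + i ≤ m → φ (Zv m (2 + i)) = ψ (Zv m (2 + i))) : φ = ψ := by
  obtain ⟨hφx, hφy, hφz⟩ := Lpqr_le_ker_iff.mp hφ
  obtain ⟨hψx, hψy, hψz⟩ := Lpqr_le_ker_iff.mp hψ
  have key : ∀ {r : ℕ} {V : ℕ → R m}, (∀ i < r, φ (V i) = 0) → (∀ i < r, ψ (V i) = 0) →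
      (∀ i, r + i ≤ m → φ (V (r + i)) = ψ (V (r + i))) → ∀ i ≤ m, φ (V i) = ψ (V i) := by
    intro r V h₁ h₂ h₃ i hi
    rcases lt_or_ge i r with h | h
    · rw [h₁ i h, h₂ i h]
    · obtain ⟨i, rfl⟩ := Nat.exists_eq_add_of_le h
      exact h₃ i hi
  refine MvPolynomial.ringHom_ext hC ?_
  rintro ⟨a, i⟩
  fin_cases a
  · simpa [Xv, i.is_le] using key hφx hψx hx i i.is_le
  · simpa [Yv, i.is_le] using key hφy hψy hy i i.is_le
  · simpa [Zv, i.is_le] using key hφz hψz hz i i.is_le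

end Construction

/-! ### The monic polynomial with given lower coefficients -/

/-- The polynomial `t^N + Σ_{i<N} a_i t^i`. -/
def monicOf {S : Type*} [CommRing S] (N : ℕ) (a : ℕ → S) : Polynomial S :=
  Polynomial.X ^ N + ∑ i ∈ Finset.range N, Polynomial.C (a i) * Polynomial.X ^ i

section MonicOf

variable {S T : Type*} [CommRing S] [CommRing T] (N : ℕ) (a : ℕ → S)

theorem degree_monicOf_tail_lt :
    (∑ i ∈ Finset.range N, Polynomial.C (a i) * Polynomial.X ^ i).degree < (N : WithBot ℕ) :=
  (Polynomial.degree_sum_le _ _).trans_lt <| (Finset.sup_lt_iff (WithBot.bot_lt_coe N)).mpr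
    fun i hi => (Polynomial.degree_C_mul_X_pow_le i (a i)).trans_lt
      (WithBot.coe_lt_coe.mpr (Finset.mem_range.mp hi))

theorem monic_monicOf : (monicOf N a).Monic :=
  Polynomial.monic_X_pow_add (degree_monicOf_tail_lt N a)

theorem natDegree_monicOf [Nontrivial S] : (monicOf N a).natDegree = N :=
  Polynomial.natDegree_eq_of_degree_eq_some <| by
    rw [monicOf, Polynomial.degree_add_eq_left_of_degree_lt] <;> rw [Polynomial.degree_X_pow]
    exact degree_monicOf_tail_lt N a

theorem coeff_monicOf {N : ℕ} {i : ℕ} (hi : i < N) : (monicOf N a).coeff i = a i := by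
  simp [monicOf, Polynomial.coeff_X_pow, hi.ne, Polynomial.finsetSum_coeff, hi]

theorem map_monicOf (φ : S →+* T) : (monicOf N a).map φ = monicOf N fun i => φ (a i) := by
  simp [monicOf, Polynomial.map_sum]

theorem eq_monicOf {N : ℕ} {P : Polynomial S} (hP : P.Monic) (hN : P.natDegree = N) :
    P = monicOf N P.coeff := by
  conv_lhs => rw [hP.as_sum, hN]
  rfl

theorem coeff_coe_mul_coe_sub_pow (P Q : Polynomial S) (n : ℕ) (z : ℕ → S) (k : ℕ) :
    PowerSeries.coeff k (arcSeries n P.coeff Q.coeff z) =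
      (P * Q).coeff k - PowerSeries.coeff k (PowerSeries.mk z ^ (n + 1)) := by
  have h : ∀ P : Polynomial S, PowerSeries.mk P.coeff = (P : PowerSeries S) :=
    fun P => by ext; simp
  rw [arcSeries, h, h, map_sub, ← Polynomial.coe_mul, Polynomial.coeff_coe]

end MonicOf

theorem map_coeff_mk_pow {S T : Type*} [CommRing S] [CommRing T] (φ : S →+* T) (a : ℕ → S)
    (e k : ℕ) : φ (PowerSeries.coeff k (PowerSeries.mk a ^ e)) =
      PowerSeries.coeff k (PowerSeries.mk (fun i => φ (a i)) ^ e) := by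
  rw [← PowerSeries.coeff_map, map_pow]
  congr 3

/-! ### Primality -/

/-- The elements of `A` that a power of `b` multiplies into the subalgebra `B`. -/
def mulPowSubalgebra {k A : Type*} [CommRing k] [CommRing A] [Algebra k A]
    (B : Subalgebra k A) {b : A} (hb : b ∈ B) : Subalgebra k A where
  carrier := {a | ∃ N : ℕ, b ^ N * a ∈ B}
  mul_mem' := by
    rintro a a' ⟨N, h⟩ ⟨N', h'⟩
    refine ⟨N + N', ?_⟩
    convert B.mul_mem h h' using 1
    ring
  add_mem' := by
    rintro a a' ⟨N, h⟩ ⟨N', h'⟩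
    refine ⟨N + N', ?_⟩
    convert B.add_mem (B.mul_mem (B.pow_mem hb N') h) (B.mul_mem (B.pow_mem hb N) h') using 1
    ring
  algebraMap_mem' c := ⟨0, by simp⟩

section Prime

variable {m n p q : ℕ}

/-- `z_2` is a nonzerodivisor modulo `L_{p,q,2} + ⟨f^{(2n+2)},…,f^{(m)}⟩`: the quotient embeds
compatibly with `z_2` into a free extension of a polynomial ring, in which the product
of the two arcs is the universal one. -/
theorem mem_Kideal_of_Zv_mul_mem (hn : 1 ≤ n) (hpq : p + q = 2 * n + 2) (hm : 2 ≤ m) {F : R m}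
    (hF : Zv m 2 * F ∈ Kideal m n p q) : F ∈ Kideal m n p q := by
  let K := Kideal m n p q
  let A := R m ⧸ K
  let π : R m →+* A := Ideal.Quotient.mk K
  have hπker : RingHom.ker π = K := Ideal.mk_ker
  rw [← Ideal.Quotient.eq_zero_iff_mem]
  change π F = 0
  rcases subsingleton_or_nontrivial A with hA | hA
  · exact Subsingleton.elim _ _
  obtain ⟨hLπ, hπ⟩ := (Kideal_le_ker_iff (φ := π) hpq).mp hπker.ge
  -- the truncated arcs completed to monic polynomials, and their roots
  let N := m + 1
  let xA : Polynomial A := monicOf N fun i => π (Xv m (p + i))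
  let yA : Polynomial A := monicOf N fun i => π (Yv m (q + i))
  have hxyA : (xA * yA).Monic := (monic_monicOf _ _).mul (monic_monicOf _ _)
  have hxyAd : (xA * yA).natDegree = 2 * N := by
    rw [(monic_monicOf _ _).natDegree_mul (monic_monicOf _ _), natDegree_monicOf,
      natDegree_monicOf, two_mul]
  obtain ⟨A₁, _, _, β₁, _, hinj₁, hβ₁, -⟩ :=
    exists_free_universal_splitting N A xA (monic_monicOf _ _) (natDegree_monicOf _ _)
  have : Nontrivial A₁ := hinj₁.nontrivial
  obtain ⟨A₂, _, _, β₂, _, hinj₂, hβ₂, -⟩ :=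
    exists_free_universal_splitting N A₁ (yA.map (algebraMap A A₁))
      ((monic_monicOf _ _).map _)
      (((monic_monicOf _ _).natDegree_map _).trans (natDegree_monicOf _ _))
  let ι : A →+* A₂ := (algebraMap A₁ A₂).comp (algebraMap A A₁)
  have hι : Function.Injective ι := hinj₂.comp hinj₁
  let β : ℕ → A₂ := fun i => if i < N then algebraMap A₁ A₂ (β₁ i) else β₂ (i - N)
  have hxβ : xA.map ι = ∏ i ∈ Finset.range N, (Polynomial.X - Polynomial.C (β i)) := by
    rw [← Polynomial.map_map, hβ₁, Polynomial.map_prod]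
    refine Finset.prod_congr rfl fun i hi => ?_
    simp [β, Finset.mem_range.mp hi]
  have hyβ : yA.map ι = ∏ i ∈ Finset.range N, (Polynomial.X - Polynomial.C (β (N + i))) := by
    rw [← Polynomial.map_map, hβ₂]
    refine Finset.prod_congr rfl fun i hi => ?_
    simp [β]
  -- the universal product
  let D := MvPolynomial (ℕ ⊕ ℕ) ℂ
  let zD : ℕ → D := fun i => X (Sum.inl i)
  let d : ℕ → D := fun k => if 2 * n + 2 + k ≤ m then
    PowerSeries.coeff k (PowerSeries.mk zD ^ (n + 1)) else X (Sum.inr k)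
  let P : Polynomial D := monicOf (2 * N) d
  let φ : D →+* A := eval₂Hom (π.comp C)
    (Sum.elim (fun i => π (Zv m (2 + i))) fun k => (xA * yA).coeff k)
  have hφz : ∀ i, φ (zD i) = π (Zv m (2 + i)) := fun i => eval₂_X _ _ _
  have hφP : P.map φ = xA * yA := by
    rw [map_monicOf, eq_monicOf hxyA hxyAd]
    congr 1
    ext k
    by_cases hk : 2 * n + 2 + k ≤ m
    · have h := hπ k hk
      rw [coeff_arcSeries_congr
        (a' := xA.coeff) (b' := yA.coeff) (c' := fun i => π (Zv m (2 + i)))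
        (fun i hi => (coeff_monicOf _ (by omega)).symm)
        (fun i hi => (coeff_monicOf _ (by omega)).symm) (fun i _ => rfl)] at h
      have h' := coeff_coe_mul_coe_sub_pow xA yA n (fun i => π (Zv m (2 + i))) k
      rw [h] at h'
      simp only [d, if_pos hk, map_coeff_mk_pow, hφz]
      exact (sub_eq_zero.mp h'.symm).symm
    · simp only [d, if_neg hk]
      exact eval₂_X _ _ _
  obtain ⟨E, _, _, α, _, hinjE, hα, huniv⟩ :=
    exists_free_universal_splitting (2 * N) D P (monic_monicOf _ _) (natDegree_monicOf _ _)
  obtain ⟨θ, hθ, hθα⟩ := huniv A₂ (ι.comp φ) β (by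
    rw [← Polynomial.map_map, hφP, Polynomial.map_mul, hxβ, hyβ, two_mul N,
      Finset.prod_range_add _ N N])
  let xE : Polynomial E := ∏ i ∈ Finset.range N, (Polynomial.X - Polynomial.C (α i))
  let yE : Polynomial E := ∏ i ∈ Finset.range N, (Polynomial.X - Polynomial.C (α (N + i)))
  have hxyE : xE * yE = P.map (algebraMap D E) := by
    rw [hα, two_mul N, Finset.prod_range_add _ N N]
  have hθx : xE.map θ = xA.map ι := by
    rw [hxβ, Polynomial.map_prod]
    refine Finset.prod_congr rfl fun i hi => ?_
    simp [hθα i (by have := Finset.mem_range.mp hi; omega)]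
  have hθy : yE.map θ = yA.map ι := by
    rw [hyβ, Polynomial.map_prod]
    refine Finset.prod_congr rfl fun i hi => ?_
    simp [hθα (N + i) (by have := Finset.mem_range.mp hi; omega)]
  let ψ : R m →+* E := arcHom m p q ((algebraMap D E).comp C) xE.coeff yE.coeff
    fun i => algebraMap D E (zD i)
  have hψK : K ≤ RingHom.ker ψ := by
    refine Kideal_le_ker_arcHom hn hpq fun k hk => ?_
    rw [coeff_coe_mul_coe_sub_pow, hxyE, Polynomial.coeff_map, coeff_monicOf _ (by omega),
      ← map_coeff_mk_pow]
    simp [d, hk]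
  have hψL : Lpqr m p q 2 ≤ RingHom.ker ψ := le_sup_left.trans hψK
  have hcomp : θ.comp ψ = ι.comp π := by
    refine ringHom_ext_of_Lpqr (p := p) (q := q) (fun a => ?_) ?_ ?_ (fun i hi => ?_)
      (fun i hi => ?_) (fun i hi => ?_)
    · have := DFunLike.congr_fun hθ (C a)
      simpa [ψ, φ] using this
    · intro g hg
      have : ψ g = 0 := hψL hg
      simp [this]
    · intro g hg
      have : π g = 0 := hπker.ge (le_sup_left (a := Lpqr m p q 2) hg)
      simp [this]
    · have := congrArg (fun f => f.coeff i) hθx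
      simp only [Polynomial.coeff_map] at this
      rw [RingHom.comp_apply, arcHom_Xv _ _ _ _ _ _ _ hi, this, coeff_monicOf _ (by omega)]
      rfl
    · have := congrArg (fun f => f.coeff i) hθy
      simp only [Polynomial.coeff_map] at this
      rw [RingHom.comp_apply, arcHom_Yv _ _ _ _ _ _ _ hi, this, coeff_monicOf _ (by omega)]
      rfl
    · rw [RingHom.comp_apply, arcHom_Zv _ _ _ _ _ _ _ hi]
      have := DFunLike.congr_fun hθ (zD i)
      simpa [hφz] using this
  have hmul : zD 0 • ψ F = 0 := by
    have h : ψ (Zv m (2 + 0) * F) = 0 := hψK hF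
    rwa [map_mul, arcHom_Zv _ _ _ _ _ _ _ (by omega), ← Algebra.smul_def] at h
  have hψF : ψ F = 0 := (smul_eq_zero.mp hmul).resolve_left (X_ne_zero _)
  apply hι
  rw [map_zero, ← RingHom.comp_apply, ← hcomp, RingHom.comp_apply, hψF, map_zero]

/-- `x_p` is a nonzerodivisor modulo `L_{p,q,2} + ⟨f^{(2n+2)},…,f^{(m)}⟩`, since
`x_p y_q = z_2^{n+1}` there. -/
theorem mem_Kideal_of_Xv_mul_mem (hn : 1 ≤ n) (hpq : p + q = 2 * n + 2) (hm : 2 * n + 2 ≤ m)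
    {F : R m} (hF : Xv m p * F ∈ Kideal m n p q) : F ∈ Kideal m n p q := by
  have hrel : Zv m 2 ^ (n + 1) - Xv m p * Yv m q ∈ Kideal m n p q := by
    have h := ((Kideal_le_ker_iff (φ := Ideal.Quotient.mk (Kideal m n p q)) hpq).mp
      Ideal.mk_ker.ge).2 0 hm
    rw [← Ideal.Quotient.eq_zero_iff_mem]
    rw [PowerSeries.coeff_zero_eq_constantCoeff_apply] at h
    simp only [arcSeries, map_sub, map_mul, map_pow,
      ← PowerSeries.coeff_zero_eq_constantCoeff_apply, PowerSeries.coeff_mk, add_zero] at h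
    rw [map_sub, map_mul, map_pow, ← neg_eq_zero, neg_sub, h]
  have hpow : ∀ e, Zv m 2 ^ e * F ∈ Kideal m n p q → F ∈ Kideal m n p q := by
    intro e
    induction e with
    | zero => simp
    | succ e ih =>
      intro h
      rw [pow_succ', mul_assoc] at h
      exact ih (mem_Kideal_of_Zv_mul_mem hn hpq (by omega) h)
  refine hpow (n + 1) ?_
  have := (Kideal m n p q).add_mem (Ideal.mul_mem_right F _ hrel) (Ideal.mul_mem_left _ (Yv m q) hF)
  convert this using 1
  ring

theorem forall_mem_of_coeff_mul_eq {k A : Type*} [CommRing k] [CommRing A] [Algebra k A]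
    {T : Subalgebra k A} {x y z : ℕ → A} (hx : ∀ i, x i ∈ T) (hz : ∀ i, z i ∈ T)
    (hx0 : ∀ a, x 0 * a ∈ T → a ∈ T) {l : ℕ} (hy : ∀ i, l ≤ i → y i ∈ T)
    (h : ∀ i < l, PowerSeries.coeff i (arcSeries n x y z) = 0) (i : ℕ) : y i ∈ T := by
  induction i using Nat.strong_induction_on with
  | _ i ih =>
    rcases le_or_gt l i with hi | hi
    · exact hy i hi
    · apply hx0
      have hrel := h i hi
      rw [arcSeries, map_sub, sub_eq_zero, PowerSeries.coeff_mul,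
        Finset.Nat.sum_antidiagonal_eq_sum_range_succ_mk, Finset.sum_range_succ',
        ← eq_sub_iff_add_eq'] at hrel
      simp only [PowerSeries.coeff_mk, Nat.sub_zero] at hrel
      rw [hrel]
      refine T.sub_mem ?_ (T.sum_mem fun t ht => T.mul_mem (hx _) (ih _ ?_))
      · have := map_coeff_mk_pow (T.val : T →+* A) (fun i => ⟨z i, hz i⟩) (n + 1) i
        exact this ▸ Subtype.coe_prop _
      · have := Finset.mem_range.mp ht
        omega

/-- The ideal `L_{p,q,2} + ⟨f^{(2n+2)},…,f^{(m)}⟩` is prime: after inverting `x_p` the equations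
can be solved for the `y_i`, so it is the kernel of a homomorphism to a field. -/
theorem isPrime_Kideal (hn : 1 ≤ n) (hpq : p + q = 2 * n + 2) (hm : 2 * n + 2 ≤ m) :
    (Kideal m n p q).IsPrime := by
  let Fr := FractionRing (R m)
  let γ : R m →+* Fr := algebraMap (R m) Fr
  have hγ : Function.Injective γ := IsFractionRing.injective (R m) Fr
  let x : ℕ → Fr := fun i => γ (Xv m (p + i))
  let z : ℕ → Fr := fun i => γ (Zv m (2 + i))
  let y' : ℕ → Fr := fun k =>
    PowerSeries.coeff k (PowerSeries.mk z ^ (n + 1) * (PowerSeries.mk x)⁻¹)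
  let y : ℕ → Fr := fun k => if 2 * n + 2 + k ≤ m then y' k else γ (Yv m (q + k))
  have hx0 : PowerSeries.constantCoeff (PowerSeries.mk x) ≠ 0 := by
    rw [← PowerSeries.coeff_zero_eq_constantCoeff_apply, PowerSeries.coeff_mk, Ne,
      map_eq_zero_iff γ hγ, Xv, dif_pos (by omega)]
    exact X_ne_zero _
  have hy' : PowerSeries.mk y' = PowerSeries.mk z ^ (n + 1) * (PowerSeries.mk x)⁻¹ :=
    PowerSeries.ext fun k => PowerSeries.coeff_mk k y'
  let φ : R m →+* Fr := arcHom m p q (γ.comp C) x y z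
  have hφK : Kideal m n p q ≤ RingHom.ker φ := by
    refine Kideal_le_ker_arcHom hn hpq fun k hk => ?_
    rw [coeff_arcSeries_congr (b' := y') (fun _ _ => rfl) (fun i hi => if_pos (by omega))
      (fun _ _ => rfl), arcSeries, hy', mul_left_comm, PowerSeries.mul_inv_cancel _ hx0, mul_one,
      sub_self, map_zero]
  -- a polynomial subring on which `φ` is injective
  let 𝒮 : Subalgebra ℂ (R m) := Algebra.adjoin ℂ
    ({g | ∃ i, p + i ≤ m ∧ g = Xv m (p + i)} ∪ {g | ∃ i, 2 + i ≤ m ∧ g = Zv m (2 + i)} ∪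
      {g | ∃ k, m < 2 * n + 2 + k ∧ q + k ≤ m ∧ g = Yv m (q + k)})
  have hφ𝒮 : ∀ s ∈ 𝒮, φ s = γ s := fun s hs => by
    induction hs using Algebra.adjoin_induction with
    | mem s hs =>
      rcases hs with (⟨i, hi, rfl⟩ | ⟨i, hi, rfl⟩) | ⟨k, hk, hk', rfl⟩
      · exact arcHom_Xv _ _ _ _ _ _ _ hi
      · exact arcHom_Zv _ _ _ _ _ _ _ hi
      · exact (arcHom_Yv _ _ _ _ _ _ _ hk').trans (if_neg (by omega))
    | algebraMap r => exact arcHom_C _ _ _ _ _ _ _ r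
    | add s t _ _ hs ht => rw [map_add, map_add, hs, ht]
    | mul s t _ _ hs ht => rw [map_mul, map_mul, hs, ht]
  let π := Ideal.Quotient.mkₐ ℂ (Kideal m n p q)
  have hXp : Xv m p ∈ 𝒮 := Algebra.subset_adjoin (.inl (.inl ⟨0, by omega, rfl⟩))
  let T := mulPowSubalgebra (𝒮.map π) (Subalgebra.mem_map.mpr ⟨_, hXp, rfl⟩)
  have hST : ∀ s ∈ 𝒮, π s ∈ T := fun s hs =>
    ⟨0, by simpa using Subalgebra.mem_map.mpr ⟨s, hs, rfl⟩⟩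
  obtain ⟨⟨hπx, hπy, hπz⟩, hπ⟩ := (Kideal_le_ker_iff (φ := π.toRingHom) hpq).mp
    (Ideal.Quotient.mkₐ_ker ℂ (Kideal m n p q)).ge
  have key : ∀ {r : ℕ} {V : ℕ → R m}, (∀ i < r, π (V i) = 0) → (∀ i, π (V (r + i)) ∈ T) →
      ∀ i, π (V i) ∈ T := fun {r V} h₁ h₂ i => by
    rcases lt_or_ge i r with h | h
    · rw [h₁ i h]
      exact T.zero_mem
    · obtain ⟨i, rfl⟩ := Nat.exists_eq_add_of_le h
      exact h₂ i
  have hX : ∀ i, π (Xv m (p + i)) ∈ T := fun i => by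
    by_cases hi : p + i ≤ m
    · exact hST _ (Algebra.subset_adjoin (.inl (.inl ⟨i, hi, rfl⟩)))
    · rw [Xv, dif_neg (by omega), map_zero]
      exact T.zero_mem
  have hZ : ∀ i, π (Zv m (2 + i)) ∈ T := fun i => by
    by_cases hi : 2 + i ≤ m
    · exact hST _ (Algebra.subset_adjoin (.inl (.inr ⟨i, hi, rfl⟩)))
    · rw [Zv, dif_neg (by omega), map_zero]
      exact T.zero_mem
  have hY : ∀ i, π (Yv m (q + i)) ∈ T := by
    refine forall_mem_of_coeff_mul_eq (n := n) (l := m + 1 - (2 * n + 2)) hX hZ ?_ ?_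
      fun i hi => hπ i (by omega)
    · rintro a ⟨N, h⟩
      refine ⟨N + 1, ?_⟩
      rwa [pow_succ, mul_assoc]
    · intro i hi
      by_cases hi' : q + i ≤ m
      · exact hST _ (Algebra.subset_adjoin (.inr ⟨i, by omega, hi', rfl⟩))
      · rw [Yv, dif_neg (by omega), map_zero]
        exact T.zero_mem
  have hT : ∀ F, π F ∈ T := fun F => by
    induction F using MvPolynomial.induction_on with
    | C a => exact T.algebraMap_mem a
    | add F G hF hG => rw [map_add]; exact T.add_mem hF hG
    | mul_X F v hF =>
      rw [map_mul]
      refine T.mul_mem hF ?_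
      obtain ⟨a, i⟩ := v
      fin_cases a
      · simpa [Xv, i.is_le] using key hπx hX i
      · simpa [Yv, i.is_le] using key hπy hY i
      · simpa [Zv, i.is_le] using key hπz hZ i
  have hpow : ∀ (N : ℕ) (F : R m), Xv m p ^ N * F ∈ Kideal m n p q → F ∈ Kideal m n p q := by
    intro N F
    induction N with
    | zero => simp
    | succ N ih =>
      intro h
      rw [pow_succ', mul_assoc] at h
      exact ih (mem_Kideal_of_Xv_mul_mem hn hpq hm h)
  suffices h : Kideal m n p q = RingHom.ker φ from h ▸ RingHom.ker_isPrime φ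
  refine le_antisymm hφK fun F hF => ?_
  obtain ⟨N, hN⟩ := hT F
  obtain ⟨s, hs, hsF⟩ := Subalgebra.mem_map.mp hN
  have hmem : Xv m p ^ N * F - s ∈ Kideal m n p q := by
    rw [← Ideal.Quotient.eq_zero_iff_mem, map_sub, map_mul, map_pow, sub_eq_zero]
    exact hsF.symm
  have hs0 : s = 0 := by
    have h := hφK hmem
    rw [RingHom.mem_ker, map_sub, map_mul, RingHom.mem_ker.mp hF, mul_zero, zero_sub,
      neg_eq_zero, hφ𝒮 s hs] at h
    exact (map_eq_zero_iff γ hγ).mp h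
  refine hpow N F ?_
  rwa [hs0, sub_zero] at hmem

end Prime

/-! ### Primes containing `I_m^i + I_m^j` -/

section LowestTerms

variable {S : Type*} [CommRing S] {p q : ℕ} {a b : ℕ → S}

theorem coeff_mk_mul_mk_of_lt (ha : ∀ i < p, a i = 0) (hb : ∀ i < q, b i = 0) {k : ℕ}
    (hk : k < p + q) : PowerSeries.coeff k (PowerSeries.mk a * PowerSeries.mk b) = 0 := by
  rw [PowerSeries.mk_eq_X_pow_mul ha, PowerSeries.mk_eq_X_pow_mul hb, mul_mul_mul_comm, ← pow_add,
    PowerSeries.coeff_X_pow_mul', if_neg (not_le.mpr hk)]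

theorem coeff_mk_mul_mk (ha : ∀ i < p, a i = 0) (hb : ∀ i < q, b i = 0) :
    PowerSeries.coeff (p + q) (PowerSeries.mk a * PowerSeries.mk b) = a p * b q := by
  rw [PowerSeries.mk_eq_X_pow_mul ha, PowerSeries.mk_eq_X_pow_mul hb, mul_mul_mul_comm, ← pow_add,
    PowerSeries.coeff_X_pow_mul', if_pos le_rfl]
  simp

theorem coeff_mk_pow_of_lt (ha : ∀ i < p, a i = 0) {e k : ℕ} (hk : k < p * e) :
    PowerSeries.coeff k (PowerSeries.mk a ^ e) = 0 := by
  rw [PowerSeries.mk_eq_X_pow_mul ha, mul_pow, ← pow_mul, PowerSeries.coeff_X_pow_mul',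
    if_neg (not_le.mpr hk)]

theorem coeff_mk_pow (ha : ∀ i < p, a i = 0) (e : ℕ) :
    PowerSeries.coeff (p * e) (PowerSeries.mk a ^ e) = a p ^ e := by
  rw [PowerSeries.mk_eq_X_pow_mul ha, mul_pow, ← pow_mul, PowerSeries.coeff_X_pow_mul',
    if_pos le_rfl]
  simp

end LowestTerms

section Components

variable {m n i j : ℕ}

theorem Iml_le_ker_iff {S : Type*} [CommRing S] {φ : R m →+* S} {l : ℕ} :
    Iml m n l ≤ RingHom.ker φ ↔
      ((∀ i < l, φ (Xv m i) = 0) ∧ (∀ i < n + 1 - l, φ (Yv m i) = 0) ∧ ∀ i < 1, φ (Zv m i) = 0) ∧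
      ∀ k ≤ m, φ (fpqr m n 0 0 0 k) = 0 := by
  rw [Iml, sup_le_iff, Lpqr_le_ker_iff, Fideal, Ideal.span_le]
  refine and_congr_right fun _ => ⟨fun h k hk => h ⟨k, hk, rfl⟩, ?_⟩
  rintro h _ ⟨k, hk, rfl⟩
  exact h k hk

/-- A homomorphism to a domain killing `I_m^i + I_m^j` kills one of the ideals
`L_{j+u,2n+2−j−u,2} + ⟨f^{(2n+2)},…,f^{(m)}⟩`; the order of vanishing of the `x`-arc decides
which. -/
theorem exists_Kml_le_ker (hm : 2 * n + 2 ≤ m) (hij : i < j) (hj : j ≤ n) {S : Type*}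
    [CommRing S] [IsDomain S] {φ : R m →+* S} (h : Iml m n i ⊔ Iml m n j ≤ RingHom.ker φ) :
    ∃ u ≤ n + 1 - (j - i), Kml m n j u ≤ RingHom.ker φ := by
  obtain ⟨⟨-, hy, hz⟩, hf⟩ := Iml_le_ker_iff.mp (le_sup_left.trans h)
  obtain ⟨⟨hx, -, -⟩, -⟩ := Iml_le_ker_iff.mp (le_sup_right.trans h)
  have hrel : ∀ k ≤ m, PowerSeries.coeff k (PowerSeries.mk (fun i => φ (Xv m i)) *
      PowerSeries.mk fun i => φ (Yv m i)) =
        PowerSeries.coeff k (PowerSeries.mk (fun i => φ (Zv m i)) ^ (n + 1)) := fun k hk => by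
    have := hf k hk
    rwa [map_fpqr, arcSeries, map_sub, sub_eq_zero] at this
  have hz1 : φ (Zv m 1) = 0 := by
    have h₁ := coeff_mk_pow hz (n + 1)
    rw [← hrel _ (by omega), coeff_mk_mul_mk_of_lt hx hy (by omega)] at h₁
    exact eq_zero_of_pow_eq_zero h₁.symm
  have hz2 : ∀ i < 2, φ (Zv m i) = 0 := fun i hi => by
    interval_cases i
    exacts [hz 0 one_pos, hz1]
  obtain ⟨p, hjp, hp, hxp, hp'⟩ : ∃ p, j ≤ p ∧ p ≤ n + 1 + i ∧ (∀ t < p, φ (Xv m t) = 0) ∧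
      (p < n + 1 + i → φ (Xv m p) ≠ 0) := by
    classical
    by_cases H : ∃ t < n + 1 + i, φ (Xv m t) ≠ 0
    · obtain ⟨hlt, hne⟩ := Nat.find_spec H
      refine ⟨Nat.find H, not_lt.mp fun hlt' => hne (hx _ hlt'), hlt.le, fun t ht => ?_,
        fun _ => hne⟩
      by_contra hne'
      exact Nat.find_min H ht ⟨ht.trans hlt, hne'⟩
    · push Not at H
      exact ⟨n + 1 + i, by omega, le_rfl, H, fun hlt => absurd hlt (lt_irrefl _)⟩
  have hyq : ∀ t < 2 * n + 2 - p, φ (Yv m t) = 0 := fun t => by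
    induction t using Nat.strong_induction_on with
    | _ t ih =>
      intro ht
      rcases lt_or_ge t (n + 1 - i) with hti | hti
      · exact hy t hti
      · have h₁ := coeff_mk_mul_mk hxp fun s hs => ih s hs (hs.trans ht)
        rw [hrel _ (by omega), coeff_mk_pow_of_lt hz2 (by omega)] at h₁
        exact (mul_eq_zero.mp h₁.symm).resolve_left (hp' (by omega))
  refine ⟨p - j, by omega, ?_⟩
  rw [show Kml m n j (p - j) = Kideal m n (j + (p - j)) (2 * n + 2 - j - (p - j)) from rfl,
    show j + (p - j) = p by omega, show 2 * n + 2 - j - (p - j) = 2 * n + 2 - p by omega, Kideal,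
    sup_le_iff, Lpqr_le_ker_iff, Fideal2, Ideal.span_le]
  refine ⟨⟨hxp, hyq, hz2⟩, ?_⟩
  rintro _ ⟨k, -, hk, rfl⟩
  exact hf k hk

theorem Iml_sup_Iml_le_Kml (hij : i < j) (hj : j ≤ n) {u : ℕ} (hu : u ≤ n + 1 - (j - i)) :
    Iml m n i ⊔ Iml m n j ≤ Kml m n j u := by
  have hker : RingHom.ker (Ideal.Quotient.mk (Kml m n j u)) = Kml m n j u := Ideal.mk_ker
  have hK : Kideal m n (j + u) (2 * n + 2 - j - u) ≤
      RingHom.ker (Ideal.Quotient.mk (Kml m n j u)) := hker.ge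
  have hpq : j + u + (2 * n + 2 - j - u) = 2 * n + 2 := by omega
  obtain ⟨⟨hx, hy, hz⟩, -⟩ := (Kideal_le_ker_iff hpq).mp hK
  have hf := fun k (hk : k ≤ m) => map_fpqr_eq_zero hpq hK hk
  rw [← hker, sup_le_iff, Iml_le_ker_iff, Iml_le_ker_iff]
  exact ⟨⟨⟨fun t ht => hx t (by omega), fun t ht => hy t (by omega), fun t ht => hz t (by omega)⟩,
    hf⟩, ⟨fun t ht => hx t (by omega), fun t ht => hy t (by omega), fun t ht => hz t (by omega)⟩,
    hf⟩

theorem isPrime_Kml (hn : 1 ≤ n) (hm : 2 * n + 2 ≤ m) {u : ℕ} (hu : j + u ≤ 2 * n + 2) :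
    (Kml m n j u).IsPrime :=
  isPrime_Kideal hn (by omega) hm

theorem radical_Iml_sup_Iml (hn : 1 ≤ n) (hm : 2 * n + 2 ≤ m) (hij : i < j) (hj : j ≤ n) :
    (Iml m n i ⊔ Iml m n j).radical =
      ⨅ u ∈ Finset.range (n + 1 - (j - i) + 1), Kml m n j u := by
  refine le_antisymm (le_iInf₂ fun u hu => ?_) ?_
  · have hu := Nat.lt_succ_iff.mp (Finset.mem_range.mp hu)
    exact (isPrime_Kml hn hm (by omega)).radical_le_iff.mpr (Iml_sup_Iml_le_Kml hij hj hu)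
  · rw [Ideal.radical_eq_sInf]
    refine le_sInf fun P ⟨hP, hprime⟩ => ?_
    have hker : RingHom.ker (Ideal.Quotient.mk P) = P := Ideal.mk_ker
    obtain ⟨u, hu, hK⟩ := exists_Kml_le_ker hm hij hj (hP.trans hker.ge)
    exact (iInf₂_le u (Finset.mem_range.mpr (Nat.lt_succ_iff.mpr hu))).trans (hK.trans hker.le)

end Components

/-! ### Zero loci -/

section ZeroLocus

variable {m : ℕ}

theorem mem_zl_iff {I : Ideal (R m)} {x : Pt m} : x ∈ zl m I ↔ I ≤ RingHom.ker (eval x) :=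
  Iff.rfl

theorem zl_sup (I J : Ideal (R m)) : zl m (I ⊔ J) = zl m I ∩ zl m J := by
  ext x
  simp only [Set.mem_inter_iff, mem_zl_iff, sup_le_iff]

theorem zl_anti {I J : Ideal (R m)} (h : I ≤ J) : zl m J ⊆ zl m I :=
  fun _ hx g hg => hx g (h hg)

theorem exists_eval_eq (φ : R m →+* ℂ) (hφ : ∀ a, φ (C a) = a) : ∃ x : Pt m, eval x = φ :=
  ⟨fun v => φ (X v), MvPolynomial.ringHom_ext (by simp [hφ]) (by simp)⟩

theorem isIrredSet_zl {I : Ideal (R m)} (hI : I.IsPrime) : IsIrredSet m (zl m I) := by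
  have hmem : ∀ g : R m, (∀ x ∈ zl m I, eval x g = 0) → g ∈ I := fun g hg => by
    rw [← hI.radical, ← vanishingIdeal_zeroLocus_eq_radical (K := ℂ)]
    intro x hx
    exact hg x hx
  refine ⟨?_, fun I₁ I₂ h => ?_⟩
  · by_contra hne
    rw [Set.not_nonempty_iff_eq_empty] at hne
    exact hI.ne_top ((Ideal.eq_top_iff_one I).mpr (hmem 1 (by simp [hne])))
  · by_contra! hnot
    obtain ⟨⟨x₁, hx₁, hx₁'⟩, x₂, hx₂, hx₂'⟩ := hnot.imp Set.not_subset.mp Set.not_subset.mp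
    obtain ⟨g₁, hg₁, hne₁⟩ : ∃ g ∈ I₁, eval x₁ g ≠ 0 := by simpa [zl] using hx₁'
    obtain ⟨g₂, hg₂, hne₂⟩ : ∃ g ∈ I₂, eval x₂ g ≠ 0 := by simpa [zl] using hx₂'
    have hmul : g₁ * g₂ ∈ I := hmem _ fun x hx => by
      rw [map_mul]
      rcases h hx with hx | hx
      · rw [hx g₁ hg₁, zero_mul]
      · rw [hx g₂ hg₂, mul_zero]
    rcases hI.mem_or_mem hmul with hg | hg
    · exact hne₁ (hx₁ _ hg)
    · exact hne₂ (hx₂ _ hg)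

theorem not_zl_Kideal_subset {n p q p' q' : ℕ} (hn : 1 ≤ n) (hm : 2 * n + 2 ≤ m)
    (hpq : p + q = 2 * n + 2) (hpq' : p' + q' = 2 * n + 2) (hne : p ≠ p') :
    ¬ zl m (Kideal m n p q) ⊆ zl m (Kideal m n p' q') := by
  intro h
  have hzero : PowerSeries.mk (fun _ => (0 : ℂ)) = 0 := by ext; simp
  have hkey : ∀ x y : ℕ → ℂ, (∀ k, 2 * n + 2 + k ≤ m →
      PowerSeries.coeff k (arcSeries n x y fun _ => 0) = 0) →
      (∀ i < p', arcHom m p q (RingHom.id ℂ) x y (fun _ => 0) (Xv m i) = 0) ∧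
      ∀ i < q', arcHom m p q (RingHom.id ℂ) x y (fun _ => 0) (Yv m i) = 0 := fun x y hxy => by
    obtain ⟨v, hv⟩ := exists_eval_eq (arcHom m p q (RingHom.id ℂ) x y fun _ => 0) (by simp)
    have hK := mem_zl_iff.mp (h (mem_zl_iff.mpr (hv ▸ Kideal_le_ker_arcHom hn hpq hxy)))
    rw [hv] at hK
    obtain ⟨⟨hx, hy, -⟩, -⟩ := (Kideal_le_ker_iff hpq').mp hK
    exact ⟨hx, hy⟩
  rcases hne.lt_or_gt with hlt | hgt
  · have := (hkey (fun _ => 1) (fun _ => 0) (by simp [arcSeries, hzero])).1 (p + 0) hlt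
    rw [arcHom_Xv _ _ _ _ _ _ _ (by omega)] at this
    exact one_ne_zero this
  · have := (hkey (fun _ => 0) (fun _ => 1) (by simp [arcSeries, hzero])).2 (q + 0) (by omega)
    rw [arcHom_Yv _ _ _ _ _ _ _ (by omega)] at this
    exact one_ne_zero this

theorem Zml_inter_Zml {n i j : ℕ} (hm : 2 * n + 2 ≤ m) (hij : i < j) (hj : j ≤ n) :
    Zml m n i ∩ Zml m n j = ⋃ u ∈ Finset.range (n + 1 - (j - i) + 1), zl m (Kml m n j u) := by
  rw [Zml, Zml, ← zl_sup]
  refine Set.Subset.antisymm (fun x hx => ?_) (Set.iUnion₂_subset fun u hu => ?_)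
  · obtain ⟨u, hu, hK⟩ := exists_Kml_le_ker hm hij hj (mem_zl_iff.mp hx)
    exact Set.mem_iUnion₂.mpr ⟨u, Finset.mem_range.mpr (Nat.lt_succ_iff.mpr hu), hK⟩
  · exact zl_anti (Iml_sup_Iml_le_Kml hij hj (Nat.lt_succ_iff.mp (Finset.mem_range.mp hu)))

end ZeroLocus

/- STATEMENT 10: for `n ≥ 2`, `m ≥ 2n + 2` and `1 ≤ i < j ≤ n`:
`√(I_m^i + I_m^j) = ⋂_{u=0}^{n+1−(j−i)} (L_{j+u, 2n+2−j−u, 2} + ⟨f^{(2n+2)},…,f^{(m)}⟩)`,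
each of these ideals is prime and none of them contains another; consequently
`Z_m^i ∩ Z_m^j = ⋃_{u=0}^{n+1−(j−i)} V(L_{j+u, 2n+2−j−u, 2} + ⟨f^{(2n+2)},…,f^{(m)}⟩)`
is the irreducible decomposition of `Z_m^i ∩ Z_m^j`. -/
theorem stmt10 (n m : ℕ) (hn : 2 ≤ n) (hm : 2 * n + 2 ≤ m) (i j : ℕ)
    (hi : 1 ≤ i) (hij : i < j) (hj : j ≤ n) :
    (Iml m n i ⊔ Iml m n j).radical =
      (⨅ u ∈ Finset.range (n + 1 - (j - i) + 1), Kml m n j u) ∧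
    (∀ u ≤ n + 1 - (j - i), (Kml m n j u).IsPrime) ∧
    (∀ u ≤ n + 1 - (j - i), ∀ v ≤ n + 1 - (j - i), u ≠ v → ¬ Kml m n j u ≤ Kml m n j v) ∧
    Zml m n i ∩ Zml m n j =
      (⋃ u ∈ Finset.range (n + 1 - (j - i) + 1), zl m (Kml m n j u)) ∧
    (∀ u ≤ n + 1 - (j - i), IsIrredSet m (zl m (Kml m n j u))) ∧
    (∀ u ≤ n + 1 - (j - i), ∀ v ≤ n + 1 - (j - i), u ≠ v →
      ¬ zl m (Kml m n j u) ⊆ zl m (Kml m n j v)) := by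
  have hsub : ∀ u ≤ n + 1 - (j - i), ∀ v ≤ n + 1 - (j - i), u ≠ v →
      ¬ zl m (Kml m n j u) ⊆ zl m (Kml m n j v) := fun u hu v hv huv =>
    not_zl_Kideal_subset (by omega) hm (by omega) (by omega) (by omega)
  have hprime : ∀ u ≤ n + 1 - (j - i), (Kml m n j u).IsPrime := fun u hu =>
    isPrime_Kml (by omega) hm (by omega)
  exact ⟨radical_Iml_sup_Iml (by omega) hm hij hj, hprime,
    fun u hu v hv huv hle => hsub v hv u hu huv.symm (zl_anti hle),
    Zml_inter_Zml hm hij hj, fun u hu => isIrredSet_zl (hprime u hu), hsub⟩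

end
end

section
/- Let n ≥ 2, m ≥ n, and 1 ≤ i < j ≤ n. Then every minimal prime over I_m^i + I_m^j gives a quotient of R_m of the same Krull dimension (Z_m^i ∩ Z_m^j is of pure dimension), and the Krull dimension of R_m/(I_m^i + I_m^j) equals: (a) 2n − (j−i) + 1 if m = n; (b)(i) 3m − n − (j−i) if 0 < m − n < j − i; (b)(ii) 2m if j − i ≤ m − n. -/
noncomputable section

open MvPolynomial

/-- The Krull dimension of an affine domain is at most its transcendence degree, hence at most the
cardinality of any finite set over which it is algebraic. -/
theorem ringKrullDim_le_card_of_isAlgebraic_adjoin {k A : Type} [Field k] [CommRing A] [IsDomain A]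
    [Algebra k A] [Algebra.FiniteType k A] (s : Finset A)
    [Algebra.IsAlgebraic (Algebra.adjoin k (s : Set A)) A] :
    ringKrullDim A ≤ s.card := by
  obtain ⟨d, g, hg, hint⟩ := exists_integral_inj_algHom_of_fg k A
  have hd : d ≤ s.card := by
    have h1 := _root_.lift_trdeg_le_of_injective g hg
    rw [MvPolynomial.trdeg_of_isDomain] at h1
    have h2 := Algebra.IsAlgebraic.trdeg_le_cardinalMk k (s : Set A)
    have h3 := h1.trans (Cardinal.lift_le.mpr h2)
    simpa using h3
  have hdim : ringKrullDim A ≤ ringKrullDim (MvPolynomial (Fin d) k) := by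
    let _ : Algebra (MvPolynomial (Fin d) k) A := g.toRingHom.toAlgebra
    have : Algebra.IsIntegral (MvPolynomial (Fin d) k) A := ⟨hint⟩
    refine Order.krullDim_le_of_strictMono
      (PrimeSpectrum.comap (algebraMap (MvPolynomial (Fin d) k) A)) fun p q hpq => ?_
    exact Ideal.IsIntegral.comap_lt_comap (I := p.asIdeal) (J := q.asIdeal) hpq
  refine hdim.trans ?_
  simpa using hd

theorem Polynomial.height_eq_height_comap_C_add_one {S : Type} [CommRing S] [IsNoetherianRing S]
    (N : Ideal (Polynomial S)) [N.IsMaximal] : N.height = (N.comap Polynomial.C).height + 1 :=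
  Polynomial.height_eq_height_add_one (N.under S) N

/-- Every maximal ideal of a polynomial ring in finitely many variables over a field has height
equal to the number of variables. -/
theorem MvPolynomial.height_eq_card_of_isMaximal {k : Type} [Field k] (σ : Type) [Finite σ]
    (M : Ideal (MvPolynomial σ k)) [M.IsMaximal] : M.height = Nat.card σ := by
  induction σ using Finite.induction_empty_option with
  | of_equiv e H =>
    have := Ideal.comap_isMaximal_of_equiv (renameEquiv k e).toRingEquiv (p := M)
    have h := H (M.comap (renameEquiv k e).toRingEquiv)
    rw [RingEquiv.height_comap] at h
    rw [h, Nat.card_congr e]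
  | h_empty =>
    have h : M.height ≤ ringKrullDim (MvPolynomial PEmpty k) :=
      Ideal.height_le_ringKrullDim_of_isPrime
    simpa using h
  | @h_option α _ IH =>
    let e := (optionEquivLeft k α).symm.toRingEquiv
    have := Ideal.comap_isMaximal_of_equiv e (p := M)
    have := Polynomial.isMaximal_comap_C_of_isJacobsonRing (M.comap e)
    rw [← RingEquiv.height_comap e, Polynomial.height_eq_height_comap_C_add_one, IH]
    simp [Nat.card_eq_fintype_card]

/-- A prime minimal over an ideal generated by `c` elements of a polynomial ring in `d` variables
over a field has a quotient of dimension at least `d - c`. -/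
theorem MvPolynomial.card_le_ringKrullDim_quotient_add_card {k : Type} [Field k] (σ : Type)
    [Finite σ] (s : Finset (MvPolynomial σ k)) (P : Ideal (MvPolynomial σ k))
    (hP : P ∈ (Ideal.span (s : Set (MvPolynomial σ k))).minimalPrimes) :
    (Nat.card σ : WithBot ℕ∞) ≤ ringKrullDim (MvPolynomial σ k ⧸ P) + s.card := by
  classical
  have hPp : P.IsPrime := hP.1.1
  set J := Ideal.span (s : Set (MvPolynomial σ k)) with hJ
  have hfin : (J.minimalPrimes \ {P}).Finite :=
    J.finite_minimalPrimes_of_isNoetherianRing.subset Set.sdiff_subset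
  have hnot : ¬ hfin.toFinset.inf id ≤ P := by
    rw [hPp.inf_le']
    rintro ⟨Q, hQ, hQP⟩
    obtain ⟨hQJ, hne⟩ := hfin.mem_toFinset.mp hQ
    exact hne (le_antisymm hQP (hP.2 hQJ.1 hQP))
  obtain ⟨g, hgQ, hgP⟩ := SetLike.not_le_iff_exists.mp hnot
  obtain ⟨M, hM, hPM, hgM⟩ : ∃ M : Ideal (MvPolynomial σ k), M.IsMaximal ∧ P ≤ M ∧ g ∉ M := by
    by_contra! hcon
    refine hgP ?_
    rw [← IsJacobsonRing.out inferInstance hPp.isRadical, Ideal.jacobson, Ideal.mem_sInf]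
    exact fun {M} hM => hcon M hM.2 hM.1
  have hunique : ∀ Q ∈ J.minimalPrimes, Q ≤ M → Q = P := by
    intro Q hQ hQM
    by_contra hne
    have : hfin.toFinset.inf id ≤ Q := Finset.inf_le (f := id) (hfin.mem_toFinset.mpr ⟨hQ, hne⟩)
    exact hgM (hQM (this hgQ))
  have hMP : (M.map (Ideal.Quotient.mk P)).IsPrime := Ideal.isPrime_map_quotientMk_of_isPrime hPM
  obtain ⟨t, ht, htc⟩ := Ideal.exists_finset_card_eq_height_of_isNoetherianRing
    (M.map (Ideal.Quotient.mk P))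
  choose f hf using Ideal.Quotient.mk_surjective (I := P)
  have hmin : M ∈ (Ideal.span ((s ∪ t.image f : Finset _) : Set (MvPolynomial σ k))).minimalPrimes := by
    refine ⟨⟨hM.isPrime, Ideal.span_le.mpr fun x hx => ?_⟩, fun Q hQ hQM => ?_⟩
    · rcases Finset.mem_union.mp hx with hx | hx
      · exact hPM (hP.1.2 (Ideal.subset_span hx))
      · obtain ⟨y, hy, rfl⟩ := Finset.mem_image.mp hx
        have : Ideal.Quotient.mk P (f y) ∈ M.map (Ideal.Quotient.mk P) := by
          rw [hf]; exact ht.1.2 (Ideal.subset_span hy)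
        rwa [Ideal.mem_quotient_iff_mem hPM] at this
    · have := hQ.1
      have hsQ : J ≤ Q := Ideal.span_le.mpr fun x hx =>
        hQ.2 (Ideal.subset_span (Finset.mem_union_left _ hx))
      obtain ⟨P', hP', hP'Q⟩ := Ideal.exists_minimalPrimes_le hsQ
      have hPQ : P ≤ Q := hunique P' hP' (hP'Q.trans hQM) ▸ hP'Q
      have hQ' : M.map (Ideal.Quotient.mk P) ≤ Q.map (Ideal.Quotient.mk P) := by
        refine ht.2 ⟨Ideal.isPrime_map_quotientMk_of_isPrime hPQ, Ideal.span_le.mpr fun y hy => ?_⟩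
          (Ideal.map_mono hQM)
        rw [← hf y]
        exact Ideal.mem_map_of_mem _ (hQ.2 (Ideal.subset_span
          (Finset.mem_union_right _ (Finset.mem_image_of_mem f hy))))
      intro x hx
      have := hQ' (Ideal.mem_map_of_mem _ hx)
      rwa [Ideal.mem_quotient_iff_mem hPQ] at this
  have hle := Ideal.height_le_card_of_mem_minimalPrimes_span_finset hmin
  rw [MvPolynomial.height_eq_card_of_isMaximal] at hle
  have hdim : ((t.card : ℕ∞) : WithBot ℕ∞) ≤ ringKrullDim (MvPolynomial σ k ⧸ P) := by
    rw [htc]; exact Ideal.height_le_ringKrullDim_of_isPrime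
  have hcard : Nat.card σ ≤ t.card + s.card := by
    refine (Nat.cast_le.mp hle).trans ((Finset.card_union_le _ _).trans ?_)
    have := Finset.card_image_le (s := t) (f := f)
    omega
  calc (Nat.card σ : WithBot ℕ∞) ≤ ((t.card + s.card : ℕ) : WithBot ℕ∞) := by exact_mod_cast hcard
    _ = ((t.card : ℕ∞) : WithBot ℕ∞) + s.card := by push_cast; rfl
    _ ≤ _ := by gcongr

/-- The dimension of a quotient is bounded by the dimensions of its prime quotients. -/
theorem ringKrullDim_quotient_le_of_forall_isPrime {A : Type} [CommRing A] (I : Ideal A)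
    (D : WithBot ℕ∞)
    (h : ∀ Q : Ideal A, Q.IsPrime → I ≤ Q → ringKrullDim (A ⧸ Q) ≤ D) :
    ringKrullDim (A ⧸ I) ≤ D := by
  rw [ringKrullDim_quotient]
  refine iSup_le fun c => ?_
  refine le_trans ?_ (h c.head.1.asIdeal c.head.1.isPrime c.head.2)
  rw [ringKrullDim_quotient]
  let c' : LTSeries (PrimeSpectrum.zeroLocus (c.head.1.asIdeal : Set A)) :=
    { length := c.length
      toFun := fun i => ⟨(c i).1, show c.head.1 ≤ (c i).1 from c.head_le i⟩
      step := fun i => c.step i }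
  exact Order.LTSeries.length_le_krullDim c'

theorem coeff_xSer_zero (m k : ℕ) : (xSer m 0).coeff k = Xv m k := by
  have h : m < k → Xv m k = 0 := fun h => by rw [Xv, dif_neg (by omega)]
  simp only [xSer, Polynomial.finsetSum_coeff, Polynomial.coeff_C_mul, Polynomial.coeff_X_pow,
    mul_ite, mul_one, mul_zero, Finset.sum_ite_eq, Finset.mem_Icc, zero_le, true_and]
  grind

theorem coeff_ySer_zero (m k : ℕ) : (ySer m 0).coeff k = Yv m k := by
  have h : m < k → Yv m k = 0 := fun h => by rw [Yv, dif_neg (by omega)]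
  simp only [ySer, Polynomial.finsetSum_coeff, Polynomial.coeff_C_mul, Polynomial.coeff_X_pow,
    mul_ite, mul_one, mul_zero, Finset.sum_ite_eq, Finset.mem_Icc, zero_le, true_and]
  grind

theorem coeff_zSer_zero (m k : ℕ) : (zSer m 0).coeff k = Zv m k := by
  have h : m < k → Zv m k = 0 := fun h => by rw [Zv, dif_neg (by omega)]
  simp only [zSer, Polynomial.finsetSum_coeff, Polynomial.coeff_C_mul, Polynomial.coeff_X_pow,
    mul_ite, mul_one, mul_zero, Finset.sum_ite_eq, Finset.mem_Icc, zero_le, true_and]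
  grind

theorem map_fpqr_s11 {m : ℕ} {A : Type} [CommRing A] (φ : R m →+* A) (n k : ℕ) :
    φ (fpqr m n 0 0 0 k) = ((xSer m 0).map φ * (ySer m 0).map φ).coeff k -
      ((zSer m 0).map φ ^ (n + 1)).coeff k := by
  rw [fpqr, ← Polynomial.coeff_map, Polynomial.map_sub, Polynomial.map_mul, Polynomial.map_pow,
    Polynomial.coeff_sub]

theorem Polynomial.coeff_mul_eq_zero_of_X_pow_dvd {A : Type} [CommRing A] {f g : Polynomial A}
    {p q k : ℕ} (hf : ∀ d < p, f.coeff d = 0) (hg : ∀ d < q, g.coeff d = 0) (hk : k < p + q) :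
    (f * g).coeff k = 0 := by
  have h := mul_dvd_mul (Polynomial.X_pow_dvd_iff.mpr hf) (Polynomial.X_pow_dvd_iff.mpr hg)
  rw [← pow_add] at h
  exact Polynomial.X_pow_dvd_iff.mp h k hk

theorem Polynomial.coeff_pow_eq_zero_of_X_pow_dvd {A : Type} [CommRing A] {f : Polynomial A}
    {r N k : ℕ} (hf : ∀ d < r, f.coeff d = 0) (hk : k < r * N) : (f ^ N).coeff k = 0 := by
  have h := pow_dvd_pow_of_dvd (Polynomial.X_pow_dvd_iff.mpr hf) N
  rw [← pow_mul] at h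
  exact Polynomial.X_pow_dvd_iff.mp h k hk

theorem Polynomial.coeff_pow_self_of_X_dvd {A : Type} [CommRing A] {f : Polynomial A}
    (N : ℕ) (hf : f.coeff 0 = 0) : (f ^ N).coeff N = f.coeff 1 ^ N := by
  obtain ⟨g, rfl⟩ := Polynomial.X_dvd_iff.mpr hf
  have h1 : (Polynomial.X * g).coeff 1 = g.coeff 0 := Polynomial.coeff_X_mul g 0
  have h2 := Polynomial.coeff_X_pow_mul (g ^ N) N 0
  rw [zero_add] at h2
  rw [h1, mul_pow, h2, Polynomial.coeff_zero_eq_eval_zero, Polynomial.coeff_zero_eq_eval_zero,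
    Polynomial.eval_pow]

theorem Lpqr_le_iff (m p q r : ℕ) (Q : Ideal (R m)) :
    Lpqr m p q r ≤ Q ↔
      (∀ k < p, Xv m k ∈ Q) ∧ (∀ k < q, Yv m k ∈ Q) ∧ ∀ k < r, Zv m k ∈ Q := by
  simp only [Lpqr, Ideal.span_le, Set.union_subset_iff, Set.image_subset_iff, and_assoc]
  rfl

theorem Fideal_le_iff (m n : ℕ) (Q : Ideal (R m)) :
    Fideal m n ≤ Q ↔ ∀ k ≤ m, fpqr m n 0 0 0 k ∈ Q := by
  rw [Fideal, Ideal.span_le]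
  exact ⟨fun h k hk => h ⟨k, hk, rfl⟩, by rintro h _ ⟨k, hk, rfl⟩; exact h k hk⟩

/-- The order of vanishing imposed on `z` along `Z_m^i ∩ Z_m^j`. -/
def zOrder (m n : ℕ) : ℕ := if m = n then 1 else 2

/-- A prime contains `I_m^i + I_m^j` if and only if it contains `x_0,…,x_{j-1}`, `y_0,…,y_{n-i}`,
`z_0` (and `z_1` if `m > n`) and the `f^{(k)}` with `n + (j - i) < k ≤ m`. -/
theorem Iml_sup_Iml_le_iff {n m i j : ℕ} (hm : n ≤ m) (hi : 1 ≤ i) (hij : i < j)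
    (hj : j ≤ n) (Q : Ideal (R m)) [hQ : Q.IsPrime] :
    Iml m n i ⊔ Iml m n j ≤ Q ↔
      (∀ k < j, Xv m k ∈ Q) ∧ (∀ k < n + 1 - i, Yv m k ∈ Q) ∧ (∀ k < zOrder m n, Zv m k ∈ Q) ∧
        ∀ k, n + 1 + (j - i) ≤ k → k ≤ m → fpqr m n 0 0 0 k ∈ Q := by
  simp only [Iml, sup_le_iff, Lpqr_le_iff, Fideal_le_iff]
  have hxc (k) : ((xSer m 0).map (Ideal.Quotient.mk Q)).coeff k = Ideal.Quotient.mk Q (Xv m k) := by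
    rw [Polynomial.coeff_map, coeff_xSer_zero]
  have hyc (k) : ((ySer m 0).map (Ideal.Quotient.mk Q)).coeff k = Ideal.Quotient.mk Q (Yv m k) := by
    rw [Polynomial.coeff_map, coeff_ySer_zero]
  have hzc (k) : ((zSer m 0).map (Ideal.Quotient.mk Q)).coeff k = Ideal.Quotient.mk Q (Zv m k) := by
    rw [Polynomial.coeff_map, coeff_zSer_zero]
  have hxy (hx : ∀ k < j, Xv m k ∈ Q) (hy : ∀ k < n + 1 - i, Yv m k ∈ Q) (k : ℕ)
      (hk : k < n + 1 + (j - i)) : ((xSer m 0).map (Ideal.Quotient.mk Q) *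
        (ySer m 0).map (Ideal.Quotient.mk Q)).coeff k = 0 :=
    Polynomial.coeff_mul_eq_zero_of_X_pow_dvd
      (fun d hd => by rw [hxc, Ideal.Quotient.eq_zero_iff_mem]; exact hx d hd)
      (fun d hd => by rw [hyc, Ideal.Quotient.eq_zero_iff_mem]; exact hy d hd) (by omega)
  constructor
  · rintro ⟨⟨⟨hxi, hyi, hz⟩, hF⟩, ⟨hx, hyj, -⟩, -⟩
    refine ⟨hx, hyi, fun k hk => ?_, fun k _ hk => hF k hk⟩
    rcases Nat.eq_zero_or_pos k with rfl | hk0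
    · exact hz 0 one_pos
    rw [zOrder] at hk
    split_ifs at hk with hmn
    · omega
    obtain rfl : k = 1 := by omega
    have h := hF (n + 1) (by omega)
    rw [← Ideal.Quotient.eq_zero_iff_mem, map_fpqr_s11, hxy hx hyi _ (by omega),
      Polynomial.coeff_pow_self_of_X_dvd _ (by
        rw [hzc, Ideal.Quotient.eq_zero_iff_mem]; exact hz 0 one_pos), zero_sub, neg_eq_zero,
      hzc] at h
    exact Ideal.Quotient.eq_zero_iff_mem.mp (eq_zero_of_pow_eq_zero h)
  · rintro ⟨hx, hy, hz, hF⟩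
    have hz0 : ∀ k < 1, Zv m k ∈ Q := fun k hk => hz k (by rw [zOrder]; split_ifs <;> omega)
    have hF' : ∀ k ≤ m, fpqr m n 0 0 0 k ∈ Q := by
      intro k hk
      by_cases hk' : n + 1 + (j - i) ≤ k
      · exact hF k hk' hk
      rw [← Ideal.Quotient.eq_zero_iff_mem, map_fpqr_s11, hxy hx hy _ (by omega),
        Polynomial.coeff_pow_eq_zero_of_X_pow_dvd (r := zOrder m n)
          (fun d hd => by rw [hzc, Ideal.Quotient.eq_zero_iff_mem]; exact hz d hd), sub_zero]
      rw [zOrder]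
      split_ifs <;> omega
    exact ⟨⟨⟨fun k hk => hx k (by omega), hy, hz0⟩, hF'⟩,
      ⟨hx, fun k hk => hy k (by omega), hz0⟩, hF'⟩

theorem Polynomial.coeff_pow_mem {A B : Type} [CommRing B] [CommRing A] [Algebra B A]
    (T : Subalgebra B A) {f : Polynomial A} (hf : ∀ k, f.coeff k ∈ T) (N k : ℕ) :
    (f ^ N).coeff k ∈ T := by
  induction N generalizing k with
  | zero =>
    rw [pow_zero, Polynomial.coeff_one]
    split_ifs
    exacts [T.one_mem, T.zero_mem]
  | succ N ih =>
    rw [pow_succ, Polynomial.coeff_mul]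
    exact T.sum_mem fun c _ => T.mul_mem (ih _) (hf _)

/-- The dimension of `Z_m^i ∩ Z_m^j`. -/
def interDim (m n i j : ℕ) : ℕ :=
  3 * (m + 1) - (j + (n + 1 - i) + zOrder m n + (m - n - (j - i)))

theorem interDim_le_ringKrullDim_quotient {n m i j : ℕ} (hm : n ≤ m) (hi : 1 ≤ i)
    (hij : i < j) (hj : j ≤ n) (P : Ideal (R m))
    (hP : P ∈ (Iml m n i ⊔ Iml m n j).minimalPrimes) :
    (interDim m n i j : WithBot ℕ∞) ≤ ringKrullDim (R m ⧸ P) := by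
  classical
  let s : Finset (R m) := (Finset.range j).image (Xv m) ∪ (Finset.range (n + 1 - i)).image (Yv m) ∪
    (Finset.range (zOrder m n)).image (Zv m) ∪
    (Finset.Icc (n + 1 + (j - i)) m).image (fpqr m n 0 0 0)
  have hs (Q : Ideal (R m)) (hQ : Q.IsPrime) :
      Ideal.span (s : Set (R m)) ≤ Q ↔ Iml m n i ⊔ Iml m n j ≤ Q := by
    rw [Iml_sup_Iml_le_iff hm hi hij hj, Ideal.span_le]
    simp only [s, Finset.coe_union, Finset.coe_image, Set.union_subset_iff, Set.image_subset_iff,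
      and_assoc, Finset.coe_range, Finset.coe_Icc]
    exact ⟨fun ⟨hx, hy, hz, hF⟩ => ⟨fun k hk => hx hk, fun k hk => hy hk, fun k hk => hz hk,
      fun k hk hk' => hF ⟨hk, hk'⟩⟩, fun ⟨hx, hy, hz, hF⟩ => ⟨fun k hk => hx k hk,
      fun k hk => hy k hk, fun k hk => hz k hk, fun k hk => hF k hk.1 hk.2⟩⟩
  have hPs : P ∈ (Ideal.span (s : Set (R m))).minimalPrimes :=
    ⟨⟨hP.1.1, (hs P hP.1.1).mpr hP.1.2⟩, fun Q hQ hQP => hP.2 ⟨hQ.1, (hs Q hQ.1).mp hQ.2⟩ hQP⟩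
  have hcard : s.card ≤ j + (n + 1 - i) + zOrder m n + (m - n - (j - i)) := by
    refine (Finset.card_union_le _ _).trans (add_le_add ((Finset.card_union_le _ _).trans
      (add_le_add ((Finset.card_union_le _ _).trans (add_le_add ?_ ?_)) ?_)) ?_)
    · simpa using Finset.card_image_le (s := Finset.range j) (f := Xv m)
    · simpa using Finset.card_image_le (s := Finset.range (n + 1 - i)) (f := Yv m)
    · simpa using Finset.card_image_le (s := Finset.range (zOrder m n)) (f := Zv m)
    · refine Finset.card_image_le.trans ?_
      rw [Nat.card_Icc]
      omega
  have h := MvPolynomial.card_le_ringKrullDim_quotient_add_card _ s P hPs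
  simp only [Nat.card_eq_fintype_card, Fintype.card_prod, Fintype.card_fin] at h
  generalize ringKrullDim (R m ⧸ P) = d at h ⊢
  induction d with
  | bot =>
    rw [WithBot.bot_add] at h
    exact absurd (le_bot_iff.mp h) (WithBot.natCast_ne_bot _)
  | coe d =>
    have h' : ((3 * (m + 1) : ℕ) : ℕ∞) ≤ d + s.card := WithBot.coe_le_coe.mp h
    have : ((interDim m n i j : ℕ) : ℕ∞) ≤ d := by
      induction d with
      | top => exact le_top
      | coe d =>
        have h'' : 3 * (m + 1) ≤ d + s.card := by exact_mod_cast h'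
        have : interDim m n i j ≤ d := by rw [interDim]; omega
        exact_mod_cast this
    exact_mod_cast this

theorem ringKrullDim_quotient_le_interDim {n m i j : ℕ} (hm : n ≤ m) (hi : 1 ≤ i)
    (hij : i < j) (hj : j ≤ n) (Q : Ideal (R m)) [hQ : Q.IsPrime]
    (hIQ : Iml m n i ⊔ Iml m n j ≤ Q) :
    ringKrullDim (R m ⧸ Q) ≤ interDim m n i j := by
  classical
  obtain ⟨hx, hy, hz, -⟩ := (Iml_sup_Iml_le_iff hm hi hij hj Q).mp hIQ
  have hF := (Fideal_le_iff m n Q).mp ((le_sup_right.trans le_sup_left).trans hIQ)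
  let φ := Ideal.Quotient.mk Q
  have hφ {g : R m} (hg : g ∈ Q) : φ g = 0 := Ideal.Quotient.eq_zero_iff_mem.mpr hg
  obtain ⟨a, haN, hxa, hne⟩ : ∃ a ≤ m - n - (j - i), (∀ k < j + a, φ (Xv m k) = 0) ∧
      (a < m - n - (j - i) → φ (Xv m (j + a)) ≠ 0) := by
    by_cases h : ∃ a, a < m - n - (j - i) ∧ φ (Xv m (j + a)) ≠ 0
    · obtain ⟨h1, h2⟩ := Nat.find_spec h
      refine ⟨Nat.find h, h1.le, fun k hk => ?_, fun _ => h2⟩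
      rcases lt_or_ge k j with hkj | hkj
      · exact hφ (hx k hkj)
      · have := Nat.find_min h (m := k - j) (by omega)
        rw [Nat.add_sub_cancel' hkj] at this
        by_contra hk0
        exact this ⟨by omega, hk0⟩
    · refine ⟨m - n - (j - i), le_rfl, fun k hk => ?_, fun h => absurd h (lt_irrefl _)⟩
      rcases lt_or_ge k j with hkj | hkj
      · exact hφ (hx k hkj)
      · by_contra hk0
        exact h ⟨k - j, by omega, by rwa [Nat.add_sub_cancel' hkj]⟩
  set q := n + 1 - i + (m - n - (j - i)) - a with hq
  let s : Finset (R m ⧸ Q) := (Finset.Icc (j + a) m).image (fun k => φ (Xv m k)) ∪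
    (Finset.Icc q m).image (fun k => φ (Yv m k)) ∪
    (Finset.Icc (zOrder m n) m).image (fun k => φ (Zv m k))
  let B := Algebra.adjoin ℂ (s : Set (R m ⧸ Q))
  let T := Subalgebra.algebraicClosure B (R m ⧸ Q)
  have hsT {g : R m ⧸ Q} (hg : g ∈ s) : g ∈ T :=
    T.algebraMap_mem (⟨g, Algebra.subset_adjoin hg⟩ : B)
  have hxT (k) : φ (Xv m k) ∈ T := by
    by_cases hk : k < j + a
    · rw [hxa k hk]; exact T.zero_mem
    by_cases hkm : k ≤ m
    · exact hsT (by simp only [s, Finset.mem_union, Finset.mem_image, Finset.mem_Icc]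
                    exact .inl (.inl ⟨k, by omega, rfl⟩))
    · rw [Xv, dif_neg (by omega), map_zero]; exact T.zero_mem
  have hzT (k) : φ (Zv m k) ∈ T := by
    by_cases hk : k < zOrder m n
    · rw [hφ (hz k hk)]; exact T.zero_mem
    by_cases hkm : k ≤ m
    · exact hsT (by simp only [s, Finset.mem_union, Finset.mem_image, Finset.mem_Icc]
                    exact .inr ⟨k, by omega, rfl⟩)
    · rw [Zv, dif_neg (by omega), map_zero]; exact T.zero_mem
  have hyT (k) : φ (Yv m k) ∈ T := by
    induction k using Nat.strong_induction_on with
    | _ k ih =>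
    by_cases hk : k < n + 1 - i
    · rw [hφ (hy k hk)]; exact T.zero_mem
    by_cases hkm : k ≤ m
    swap
    · rw [Yv, dif_neg (by omega), map_zero]; exact T.zero_mem
    by_cases hkq : q ≤ k
    · exact hsT (by simp only [s, Finset.mem_union, Finset.mem_image, Finset.mem_Icc]
                    exact .inl (.inr ⟨k, by omega, rfl⟩))
    have hne' := hne (by omega)
    have h0 := hφ (hF (j + a + k) (by omega))
    rw [map_fpqr_s11, Polynomial.coeff_mul, sub_eq_zero,
      ← Finset.add_sum_erase _ _ (a := (j + a, k)) (by simp)] at h0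
    simp only [Polynomial.coeff_map, coeff_xSer_zero, coeff_ySer_zero] at h0
    have hmem : φ (Xv m (j + a)) * φ (Yv m k) ∈ T := by
      rw [eq_sub_of_add_eq h0]
      refine T.sub_mem (Polynomial.coeff_pow_mem T (fun d => ?_) _ _) (T.sum_mem fun c hc => ?_)
      · rw [Polynomial.coeff_map, coeff_zSer_zero]; exact hzT d
      · obtain ⟨hc1, hc2⟩ := Finset.mem_erase.mp hc
        have hc3 := Finset.HasAntidiagonal.mem_antidiagonal.mp hc2
        by_cases hlt : c.1 < j + a
        · rw [hxa _ hlt, zero_mul]; exact T.zero_mem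
        · have : c.2 < k := by
            by_contra hge
            exact hc1 (Prod.ext (by simp only; omega) (by simp only; omega))
          exact T.mul_mem (hxT _) (ih _ this)
    exact IsAlgebraic.of_mul (mem_nonZeroDivisors_of_ne_zero hne') (hxT _) hmem
  have hT (g : R m) : φ g ∈ T := by
    induction g using MvPolynomial.induction_on with
    | C c => exact T.algebraMap_mem (algebraMap ℂ B c)
    | add f g hf hg => rw [map_add]; exact T.add_mem hf hg
    | mul_X f v hf =>
      rw [map_mul]
      refine T.mul_mem hf ?_
      obtain ⟨t, k⟩ := v
      fin_cases t
      · simpa [Xv, Nat.le_of_lt_succ k.2] using hxT k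
      · simpa [Yv, Nat.le_of_lt_succ k.2] using hyT k
      · simpa [Zv, Nat.le_of_lt_succ k.2] using hzT k
  have : Algebra.IsAlgebraic B (R m ⧸ Q) := ⟨fun b => by
    obtain ⟨g, rfl⟩ := Ideal.Quotient.mk_surjective b
    exact hT g⟩
  refine (ringKrullDim_le_card_of_isAlgebraic_adjoin (k := ℂ) s).trans ?_
  have hcard : s.card ≤ (m + 1 - (j + a)) + (m + 1 - q) + (m + 1 - zOrder m n) := by
    simp only [← Nat.card_Icc]
    exact (Finset.card_union_le _ _).trans (add_le_add ((Finset.card_union_le _ _).trans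
      (add_le_add Finset.card_image_le Finset.card_image_le)) Finset.card_image_le)
  have : s.card ≤ interDim m n i j := by
    rw [interDim]
    rw [zOrder] at hcard ⊢
    split_ifs at hcard ⊢ <;> omega
  exact_mod_cast this

theorem Iml_sup_Iml_ne_top {n m i j : ℕ} (hm : n ≤ m) (hi : 1 ≤ i) (hij : i < j)
    (hj : j ≤ n) : Iml m n i ⊔ Iml m n j ≠ ⊤ := by
  let φ : R m →+* ℂ := (eval (0 : Fin 3 × Fin (m + 1) → ℂ))
  have hx (k) : φ (Xv m k) = 0 := by rw [Xv]; split_ifs <;> simp [φ]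
  have hy (k) : φ (Yv m k) = 0 := by rw [Yv]; split_ifs <;> simp [φ]
  have hz (k) : φ (Zv m k) = 0 := by rw [Zv]; split_ifs <;> simp [φ]
  have hle : Iml m n i ⊔ Iml m n j ≤ RingHom.ker φ := by
    have := RingHom.ker_isPrime φ
    rw [Iml_sup_Iml_le_iff hm hi hij hj]
    refine ⟨fun k _ => hx k, fun k _ => hy k, fun k _ => hz k, fun k _ _ => ?_⟩
    have hx0 : (xSer m 0).map φ = 0 := by
      ext k; rw [Polynomial.coeff_map, coeff_xSer_zero, hx, Polynomial.coeff_zero]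
    have hz0 : (zSer m 0).map φ = 0 := by
      ext k; rw [Polynomial.coeff_map, coeff_zSer_zero, hz, Polynomial.coeff_zero]
    rw [RingHom.mem_ker, map_fpqr_s11, hx0, hz0]
    simp
  intro h
  exact RingHom.ker_ne_top φ (top_le_iff.mp (h ▸ hle))

/- STATEMENT 11: for `n ≥ 2`, `m ≥ n`, `1 ≤ i < j ≤ n`: `Z_m^i ∩ Z_m^j` is of pure
dimension (every minimal prime over `I_m^i + I_m^j` gives a quotient of the same Krull
dimension), and the Krull dimension of `R_m/(I_m^i + I_m^j)` equals
(a) `2n − (j−i) + 1` if `m = n`; (b)(i) `3m − n − (j−i)` if `0 < m − n < j − i`;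
(b)(ii) `2m` if `j − i ≤ m − n`. -/
theorem stmt11 (n m : ℕ) (hn : 2 ≤ n) (hm : n ≤ m) (i j : ℕ)
    (hi : 1 ≤ i) (hij : i < j) (hj : j ≤ n) :
    (∀ P ∈ (Iml m n i ⊔ Iml m n j).minimalPrimes,
      ringKrullDim (R m ⧸ P) = ringKrullDim (R m ⧸ (Iml m n i ⊔ Iml m n j))) ∧
    (m = n →
      ringKrullDim (R m ⧸ (Iml m n i ⊔ Iml m n j)) = ((2 * n - (j - i) + 1 : ℕ) : WithBot (WithTop ℕ))) ∧
    (0 < m - n → m - n < j - i →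
      ringKrullDim (R m ⧸ (Iml m n i ⊔ Iml m n j)) = ((3 * m - n - (j - i) : ℕ) : WithBot (WithTop ℕ))) ∧
    (j - i ≤ m - n →
      ringKrullDim (R m ⧸ (Iml m n i ⊔ Iml m n j)) = ((2 * m : ℕ) : WithBot (WithTop ℕ))) := by
  have hminimal (P) (hP : P ∈ (Iml m n i ⊔ Iml m n j).minimalPrimes) :
      ringKrullDim (R m ⧸ P) = interDim m n i j :=
    have := hP.1.1
    le_antisymm (ringKrullDim_quotient_le_interDim hm hi hij hj P hP.1.2)
      (interDim_le_ringKrullDim_quotient hm hi hij hj P hP)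
  have hdim : ringKrullDim (R m ⧸ (Iml m n i ⊔ Iml m n j)) = interDim m n i j := by
    refine le_antisymm (ringKrullDim_quotient_le_of_forall_isPrime _ _ fun Q _ hQ =>
      ringKrullDim_quotient_le_interDim hm hi hij hj Q hQ) ?_
    obtain ⟨P, hP⟩ := Ideal.nonempty_minimalPrimes (Iml_sup_Iml_ne_top hm hi hij hj)
    rw [← hminimal P hP]
    exact ringKrullDim_le_of_surjective (Ideal.Quotient.factor hP.1.2)
      (Ideal.Quotient.factor_surjective hP.1.2)
  refine ⟨fun P hP => (hminimal P hP).trans hdim.symm, fun h => ?_, fun h h' => ?_, fun h => ?_⟩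
  all_goals
    rw [hdim]
    refine congrArg Nat.cast ?_
    rw [interDim, zOrder]
    split_ifs <;> omega

end
end
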